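/- arXiv:math/0209216 — 2 statements merged into one kernel-verified Lean document; each statement's English description precedes it below -/
import Mathlib

section
/- Let R = k[x,y,z] localized at (x,y,z) where k is a field, and let I = (x) ∩ (y,z). Then Hom_R(R/I, H^2_I(R)) is not a finitely generated R-module, and consequently H^1_I(R) and H^2_I(R) are not I-cofinite. -/
open CategoryTheory

noncomputable section

universe u

/-- The Krull dimension of a module: `dim R/ann(M)`. -/
def moduleDim (R : Type u) [CommRing R] (M : Type*) [AddCommGroup M] [Module R M] :
    WithBot (WithTop ℕ) :=
  ringKrullDim (R ⧸ Module.annihilator R M)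

/-- The depth of `M` with respect to an ideal `J`: the supremum of the lengths of
`M`-regular sequences consisting of elements of `J`. -/
def moduleDepth (R : Type u) [CommRing R] (J : Ideal R) (M : Type*) [AddCommGroup M]
    [Module R M] : ℕ∞ :=
  sSup {n : ℕ∞ | ∃ rs : List R, (rs.length : ℕ∞) = n ∧ (∀ r ∈ rs, r ∈ J) ∧
    RingTheory.Sequence.IsRegular M rs}

/-- Serre's condition `S_ℓ` : for every prime `p` in the support of `M`,
`depth M_p ≥ min (ℓ, dim M_p)`. -/
def SerreCondition (R : Type u) [CommRing R] (ℓ : ℕ) (M : Type u) [AddCommGroup M]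
    [Module R M] : Prop :=
  ∀ p ∈ Module.support R M,
    min ((ℓ : ℕ∞) : WithBot ℕ∞)
        (moduleDim (Localization.AtPrime p.asIdeal) (LocalizedModule p.asIdeal.primeCompl M)) ≤
      ((moduleDepth (Localization.AtPrime p.asIdeal)
          (IsLocalRing.maximalIdeal (Localization.AtPrime p.asIdeal))
          (LocalizedModule p.asIdeal.primeCompl M) : ℕ∞) : WithBot ℕ∞)

/-- A module `N` over `S` is `J`-cofinite if its support is contained in `V(J)` and all the
modules `Ext^i_S(S/J, N)` are finitely generated. -/
def IsCofinite (S : Type u) [CommRing S] (J : Ideal S) (N : ModuleCat.{u} S) : Prop :=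
  Module.support S N ⊆ PrimeSpectrum.zeroLocus (J : Set S) ∧
  ∀ i : ℕ, Module.Finite S
    (((Ext S (ModuleCat.{u} S) i).obj (Opposite.op (ModuleCat.of S (S ⧸ J)))).obj N)

/-- A ring is catenary if any two saturated chains of primes with the same endpoints have
the same length. -/
def IsCatenaryRing (R : Type u) [CommRing R] : Prop :=
  ∀ c₁ c₂ : LTSeries (PrimeSpectrum R),
    c₁.head = c₂.head → c₁.last = c₂.last →
    (∀ i : Fin c₁.length, c₁.toFun i.castSucc ⋖ c₁.toFun i.succ) →
    (∀ i : Fin c₂.length, c₂.toFun i.castSucc ⋖ c₂.toFun i.succ) →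
    c₁.length = c₂.length

/-- A module is indecomposable if it is nonzero and is not the internal direct sum of two
nonzero submodules. -/
def ModuleIndecomposable (R : Type u) [CommRing R] (M : Type*) [AddCommGroup M]
    [Module R M] : Prop :=
  Nontrivial M ∧ ∀ N₁ N₂ : Submodule R M, IsCompl N₁ N₂ → N₁ = ⊥ ∨ N₂ = ⊥

/-- A module is equidimensional if `dim R/P = dim M` for every minimal prime `P`
of its support (equivalently, of its annihilator). -/
def Equidimensional (R : Type u) [CommRing R] (M : Type*) [AddCommGroup M]
    [Module R M] : Prop :=
  ∀ P ∈ (Module.annihilator R M).minimalPrimes, ringKrullDim (R ⧸ P) = moduleDim R M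

/-- A local ring is Cohen-Macaulay if its depth equals its Krull dimension. -/
def IsCMLocalRing (S : Type u) [CommRing S] [IsLocalRing S] : Prop :=
  ((moduleDepth S (IsLocalRing.maximalIdeal S) S : ℕ∞) : WithBot ℕ∞) = ringKrullDim S

/-- A ring is Cohen-Macaulay if all its localizations at primes are Cohen-Macaulay local
rings. -/
def IsCMRing (S : Type u) [CommRing S] : Prop :=
  ∀ p : PrimeSpectrum S, IsCMLocalRing (Localization.AtPrime p.asIdeal)
open MvPolynomial in
/-- The maximal ideal `(x, y, z)` of `k[x,y,z]`. -/
def P13 (k : Type u) [Field k] : Ideal (MvPolynomial (Fin 3) k) :=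
  Ideal.span {X 0, X 1, X 2}

open MvPolynomial in
theorem P13_isPrime (k : Type u) [Field k] : (P13 k).IsPrime := by
  have h : P13 k = RingHom.ker (constantCoeff : MvPolynomial (Fin 3) k →+* k) := by
    have hset : ({X 0, X 1, X 2} : Set (MvPolynomial (Fin 3) k)) = X '' Set.univ := by
      ext p
      simp only [Set.image_univ, Set.mem_range, Set.mem_insert_iff, Set.mem_singleton_iff]
      constructor
      · rintro (rfl | rfl | rfl) <;> exact ⟨_, rfl⟩
      · rintro ⟨i, rfl⟩; fin_cases i <;> simp
    rw [P13, hset]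
    ext p
    rw [mem_ideal_span_X_image, RingHom.mem_ker, constantCoeff_eq]
    constructor
    · intro hp
      by_contra hne
      obtain ⟨i, -, hi⟩ := hp 0 (MvPolynomial.mem_support_iff.mpr hne)
      simp at hi
    · intro hp m hm
      by_contra hall
      push Not at hall
      have hm0 : m = 0 := by
        ext i
        simpa using hall i (Set.mem_univ i)
      rw [hm0] at hm
      exact (MvPolynomial.mem_support_iff.mp hm) hp
  rw [h]
  exact RingHom.ker_isPrime _

attribute [instance] P13_isPrime

open MvPolynomial in
/-- `k[x,y,z]` localized at `(x,y,z)`. -/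
abbrev R13 (k : Type u) [Field k] := Localization.AtPrime (P13 k)

open MvPolynomial in
/-- The ideal `(x) ∩ (y,z)` of `R13 k`. -/
def I13 (k : Type u) [Field k] : Ideal (R13 k) :=
  Ideal.span {algebraMap (MvPolynomial (Fin 3) k) (R13 k) (X 0)} ⊓
    Ideal.span {algebraMap (MvPolynomial (Fin 3) k) (R13 k) (X 1),
      algebraMap (MvPolynomial (Fin 3) k) (R13 k) (X 2)}

section
open Limits
variable {R : Type u} [CommRing R]

namespace CategoryTheory.ProjectiveResolution
variable {X : ModuleCat.{u} R} (P : ProjectiveResolution X) (n : ℕ) (Y : ModuleCat.{u} R)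

/-- The complex `Hom(P, Y)`, as a chain complex in the opposite category. -/
abbrev homComplexOp : ChainComplex (ModuleCat.{u} R)ᵒᵖ ℕ :=
  (((linearYoneda R (ModuleCat.{u} R)).obj Y).rightOp.mapHomologicalComplex _).obj P.complex

/-- The left derived functors defining `Ext` are the homology of `homComplexOp`. -/
def leftDerivedIsoHomology :
    (((linearYoneda R (ModuleCat.{u} R)).obj Y).rightOp.leftDerived n).obj X ≅
      (P.homComplexOp Y).homology n :=
  P.isoLeftDerivedObj ((linearYoneda R (ModuleCat.{u} R)).obj Y).rightOp n

abbrev extCocycles : ModuleCat.{u} R := ((P.homComplexOp Y).opcycles n).unop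

def extCocyclesι : P.extCocycles n Y ⟶ ModuleCat.of R (P.complex.X n ⟶ Y) :=
  ((P.homComplexOp Y).pOpcycles n).unop

def extClass : P.extCocycles n Y ⟶ ((Ext R (ModuleCat.{u} R) n).obj (Opposite.op X)).obj Y :=
  ((P.leftDerivedIsoHomology n Y).hom ≫
    (P.homComplexOp Y).homologyι n).unop

instance : Mono (P.extCocyclesι n Y) := by
  exact unop_mono_of_epi ((P.homComplexOp Y).pOpcycles n)

instance : Epi (P.extClass n Y) := by
  have := mono_comp (P.leftDerivedIsoHomology n Y).hom
    ((P.homComplexOp Y).homologyι n)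
  exact unop_epi_of_mono _

lemma exists_extCocyclesι_eq (φ : P.complex.X n ⟶ Y) (hφ : P.complex.d (n + 1) n ≫ φ = 0) :
    ∃ a, P.extCocyclesι n Y a = φ := by
  let K := P.homComplexOp Y
  have hS : (ShortComplex.mk (K.d (n + 1) n) (K.pOpcycles n) (by simp)).Exact :=
    ShortComplex.exact_of_g_is_cokernel _ (K.opcyclesIsCokernel (n + 1) n (by simp))
  exact (ShortComplex.moduleCat_exact_iff _).1 hS.unop φ hφ

lemma extClass_eq_zero_iff (a : P.extCocycles (n + 1) Y) :
    P.extClass (n + 1) Y a = 0 ↔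
      ∃ ψ : P.complex.X n ⟶ Y, P.extCocyclesι (n + 1) Y a = P.complex.d (n + 1) n ≫ ψ := by
  let K := P.homComplexOp Y
  let e := P.leftDerivedIsoHomology (n + 1) Y
  have hz : (e.hom ≫ K.homologyι (n + 1)) ≫ K.fromOpcycles (n + 1) n = 0 := by simp
  have hS : (ShortComplex.mk (e.hom ≫ K.homologyι (n + 1)) (K.fromOpcycles (n + 1) n)
      hz).Exact := by
    have := ShortComplex.exact_of_f_is_kernel (ShortComplex.mk (K.homologyι (n + 1))
      (K.fromOpcycles (n + 1) n) (by simp)) (K.homologyIsKernel (n + 1) n (by simp))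
    refine (ShortComplex.exact_iff_of_iso ?_).1 this
    exact ShortComplex.isoMk e.symm (Iso.refl _) (Iso.refl _) (by simp) (by simp)
  have hι : (K.fromOpcycles (n + 1) n).unop ≫ P.extCocyclesι (n + 1) Y = (K.d (n + 1) n).unop :=
    congrArg Quiver.Hom.unop (K.p_fromOpcycles (n + 1) n)
  constructor
  · intro h
    obtain ⟨ψ, hψ⟩ := (ShortComplex.moduleCat_exact_iff _).1 hS.unop a h
    refine ⟨ψ, ?_⟩
    have := congrArg (fun f => ModuleCat.Hom.hom f ψ) hι
    rw [← hψ]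
    exact this
  · rintro ⟨ψ, hψ⟩
    have h1 : a = (K.fromOpcycles (n + 1) n).unop ψ := by
      apply (ModuleCat.mono_iff_injective (P.extCocyclesι (n + 1) Y)).1 inferInstance
      rw [hψ]
      exact (congrArg (fun f => ModuleCat.Hom.hom f ψ) hι).symm
    rw [h1]
    exact congrArg (fun f => ModuleCat.Hom.hom f ψ) (congrArg Quiver.Hom.unop hz)

lemma extClass_naturality {X' : ModuleCat.{u} R} (P' : ProjectiveResolution X') (f : X' ⟶ X)
    (g : P'.complex ⟶ P.complex) (comm : g.f 0 ≫ P.π.f 0 = P'.π.f 0 ≫ f)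
    (a : P.extCocycles n Y) (a' : P'.extCocycles n Y)
    (h : P'.extCocyclesι n Y a' = g.f n ≫ P.extCocyclesι n Y a) :
    ((Ext R (ModuleCat.{u} R) n).map f.op).app Y (P.extClass n Y a) = P'.extClass n Y a' := by
  let F := ((linearYoneda R (ModuleCat.{u} R)).obj Y).rightOp
  let G := (F.mapHomologicalComplex (ComplexShape.down ℕ)).map g
  have h1 : a' = (HomologicalComplex.opcyclesMap G n).unop a := by
    apply (ModuleCat.mono_iff_injective (P'.extCocyclesι n Y)).1 inferInstance
    rw [h]
    exact (congrArg (fun f => ModuleCat.Hom.hom f a)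
      (congrArg Quiver.Hom.unop (HomologicalComplex.p_opcyclesMap G n))).symm
  have h2 : (F.leftDerived n).map f ≫ (P.leftDerivedIsoHomology n Y).hom =
      (P'.leftDerivedIsoHomology n Y).hom ≫ HomologicalComplex.homologyMap G n :=
    isoLeftDerivedObj_hom_naturality f P' P g comm F n
  have h3 : (F.leftDerived n).map f ≫ (P.leftDerivedIsoHomology n Y).hom ≫
      (P.homComplexOp Y).homologyι n = ((P'.leftDerivedIsoHomology n Y).hom ≫
        (P'.homComplexOp Y).homologyι n) ≫ HomologicalComplex.opcyclesMap G n := by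
    rw [← Category.assoc, h2, Category.assoc, Category.assoc,
      ← HomologicalComplex.homologyι_naturality]
  rw [h1]
  exact congrArg (fun f => ModuleCat.Hom.hom f a) (congrArg Quiver.Hom.unop h3)

lemma extCocyclesι_injective : Function.Injective (P.extCocyclesι n Y) :=
  (ModuleCat.mono_iff_injective _).1 inferInstance

lemma extClass_surjective : Function.Surjective (P.extClass n Y) :=
  (ModuleCat.epi_iff_surjective _).1 inferInstance

variable {n Y} {N : Type*} [AddCommGroup N] [Module R N]

/-- A linear family of cocycles gives a linear family of elements of `extCocycles`. -/
def extCocyclesLift (c : N →ₗ[R] (P.complex.X n ⟶ Y))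
    (hc : ∀ x, P.complex.d (n + 1) n ≫ c x = 0) : N →ₗ[R] P.extCocycles n Y :=
  (LinearEquiv.ofInjective (P.extCocyclesι n Y).hom (P.extCocyclesι_injective n Y)).symm ∘ₗ
    c.codRestrict (LinearMap.range (P.extCocyclesι n Y).hom) fun x =>
      P.exists_extCocyclesι_eq n Y (c x) (hc x)

lemma extCocyclesι_lift (c : N →ₗ[R] (P.complex.X n ⟶ Y))
    (hc : ∀ x, P.complex.d (n + 1) n ≫ c x = 0) (x : N) :
    P.extCocyclesι n Y (P.extCocyclesLift c hc x) = c x :=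
  congrArg Subtype.val ((LinearEquiv.ofInjective (P.extCocyclesι n Y).hom
    (P.extCocyclesι_injective n Y)).apply_symm_apply (c.codRestrict
        (LinearMap.range (P.extCocyclesι n Y).hom)
      (fun x => P.exists_extCocyclesι_eq n Y (c x) (hc x)) x))

lemma d_comp_extCocyclesι (a : P.extCocycles n Y) :
    P.complex.d (n + 1) n ≫ P.extCocyclesι n Y a = 0 :=
  congrArg (fun f => ModuleCat.Hom.hom f a)
    (congrArg Quiver.Hom.unop ((P.homComplexOp Y).d_pOpcycles (n + 1) n))

end CategoryTheory.ProjectiveResolution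

namespace TwoGenerated
variable {R : Type u} [CommRing R] (u a b : R)

/-- The terms of the free resolution `0 → R → R² → R` of `R/(ua, ub)`. -/
def resX : ℕ → ModuleCat.{u} R
  | 0 => ModuleCat.of R R
  | 1 => ModuleCat.of R (R × R)
  | 2 => ModuleCat.of R R
  | _ + 3 => ModuleCat.of R PUnit.{u + 1}

def d₁ : R × R →ₗ[R] R := u • (a • LinearMap.fst R R R + b • LinearMap.snd R R R)

def d₂ : R →ₗ[R] R × R := (b • LinearMap.id).prod (-(a • LinearMap.id))

@[simp] lemma d₁_apply (p : R × R) : d₁ u a b p = u * (a * p.1 + b * p.2) := by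
  simp [d₁, mul_add]

@[simp] lemma d₂_apply (r : R) : d₂ a b r = (b * r, -(a * r)) := by simp [d₂]

lemma d₁_comp_d₂ : d₁ u a b ∘ₗ d₂ a b = 0 := by
  ext
  simp only [LinearMap.comp_apply, d₁_apply, d₂_apply, LinearMap.zero_apply]
  ring

abbrev ideal : Ideal R := Ideal.span {u * a, u * b}

lemma range_d₁ : LinearMap.range (d₁ u a b) = ideal u a b := by
  ext r
  simp only [LinearMap.mem_range, d₁_apply, Prod.exists, Ideal.mem_span_pair]
  exact exists₂_congr fun p q => by
    rw [show p * (u * a) + q * (u * b) = u * (a * p + b * q) by ring]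

variable {u a b} in
lemma ker_d₁ (hu : ∀ r, u * r = 0 → r = 0) (ha : ∀ r, a * r = 0 → r = 0)
    (hab : ∀ r, a ∣ b * r → a ∣ r) : LinearMap.ker (d₁ u a b) ≤ LinearMap.range (d₂ a b) := by
  rintro ⟨p, q⟩ hx
  rw [LinearMap.mem_ker, d₁_apply] at hx
  have h1 := hu _ hx
  obtain ⟨c, hc⟩ := hab q ⟨-p, by linear_combination h1⟩
  refine ⟨-c, ?_⟩
  have h2 : p + b * c = 0 := ha _ (by rw [← h1, hc]; ring)
  rw [d₂_apply, hc]
  ext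
  · linear_combination -h2
  · simp

variable {a} in
lemma ker_d₂ (ha : ∀ r, a * r = 0 → r = 0) : LinearMap.ker (d₂ a b) = ⊥ := by
  refine (Submodule.eq_bot_iff _).2 fun x hx => ha x ?_
  have hx2 := congrArg Prod.snd hx
  rw [d₂_apply] at hx2
  simpa using hx2

def resD : ∀ n, resX (R := R) (n + 1) ⟶ resX n
  | 0 => ModuleCat.ofHom (d₁ u a b)
  | 1 => ModuleCat.ofHom (d₂ a b)
  | _ + 2 => 0

lemma resD_comp : ∀ n, resD u a b (n + 1) ≫ resD u a b n = 0
  | 0 => ModuleCat.hom_ext (d₁_comp_d₂ u a b)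
  | _ + 1 => Limits.zero_comp

/-- The complex `0 → R → R² → R`. -/
def resComplex : ChainComplex (ModuleCat.{u} R) ℕ :=
  ChainComplex.of resX (resD u a b) (resD_comp u a b)

@[simp] lemma resComplex_d (n : ℕ) : (resComplex u a b).d (n + 1) n = resD u a b n :=
  ChainComplex.of_d _ _ _

instance (n : ℕ) : Projective ((resComplex u a b).X n) := by
  change Projective (resX n)
  match n with
  | 0 => exact inferInstanceAs (Projective (ModuleCat.of R R))
  | 1 => exact inferInstanceAs (Projective (ModuleCat.of R (R × R)))
  | 2 => exact inferInstanceAs (Projective (ModuleCat.of R R))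
  | _ + 3 => exact inferInstanceAs (Projective (ModuleCat.of R PUnit.{u + 1}))

lemma mkQ_comp : ModuleCat.ofHom (d₁ u a b) ≫ ModuleCat.ofHom (ideal u a b).mkQ = 0 := by
  apply ModuleCat.hom_ext
  refine LinearMap.ext fun p => ?_
  exact (Submodule.Quotient.mk_eq_zero _).2 (range_d₁ u a b ▸ ⟨p, rfl⟩)

def resπ : resComplex u a b ⟶ (ChainComplex.single₀ _).obj (ModuleCat.of R (R ⧸ ideal u a b)) :=
  (ChainComplex.toSingle₀Equiv _ _).symm ⟨ModuleCat.ofHom (ideal u a b).mkQ, by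
    rw [resComplex_d]
    exact mkQ_comp u a b⟩

@[simp] lemma resπ_f_zero : (resπ u a b).f 0 = ModuleCat.ofHom (ideal u a b).mkQ :=
  ChainComplex.toSingle₀Equiv_symm_apply_f_zero _ _

variable {u a b}

lemma quasiIso_resπ (hu : ∀ r, u * r = 0 → r = 0) (ha : ∀ r, a * r = 0 → r = 0)
    (hab : ∀ r, a ∣ b * r → a ∣ r) : QuasiIso (resπ u a b) where
  quasiIsoAt n := by
    match n with
    | 0 =>
      rw [ChainComplex.quasiIsoAt₀_iff, ShortComplex.quasiIso_iff_of_zeros']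
      · let S : ShortComplex (ModuleCat.{u} R) := ShortComplex.mk (ModuleCat.ofHom (d₁ u a b))
          (ModuleCat.ofHom (ideal u a b).mkQ) (mkQ_comp u a b)
        have hS : S.Exact ∧ Epi S.g := by
          refine ⟨(ShortComplex.moduleCat_exact_iff _).2 fun x hx => ?_,
            (ModuleCat.epi_iff_surjective _).2 (Submodule.mkQ_surjective _)⟩
          have : x ∈ ideal u a b := (Submodule.Quotient.mk_eq_zero _).1 hx
          rwa [← range_d₁] at this
        refine (ShortComplex.exact_and_epi_g_iff_of_iso ?_).2 hS
        refine ShortComplex.isoMk (Iso.refl _) (Iso.refl _) (Iso.refl _) ?_ ?_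
        · exact (Category.id_comp _).trans ((resComplex_d u a b 0).symm.trans (Category.comp_id _).symm)
        · exact (Category.id_comp _).trans ((resπ_f_zero u a b).symm.trans (Category.comp_id _).symm)
      all_goals rfl
    | n + 1 =>
      rw [quasiIsoAt_iff_exactAt' _ _ (ChainComplex.exactAt_succ_single_obj _ _),
        HomologicalComplex.exactAt_iff' _ (n + 2) (n + 1) n (by simp) (by simp),
        ShortComplex.moduleCat_exact_iff]
      intro x hx
      change (resComplex u a b).d (n + 1) n x = 0 at hx
      change ∃ y, (resComplex u a b).d (n + 2) (n + 1) y = x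
      rw [resComplex_d] at hx ⊢
      match n with
      | 0 => exact ker_d₁ hu ha hab hx
      | 1 =>
        have hx' : x ∈ LinearMap.ker (d₂ a b) := hx
        rw [ker_d₂ b ha] at hx'
        exact ⟨0, (map_zero _).trans (show x = 0 from hx').symm⟩
      | n + 2 => exact ⟨0, Subsingleton.elim (α := PUnit) _ _⟩

/-- The free resolution `0 → R → R² → R` of `R/(ua, ub)`, for `u` regular and `a, b` a regular
sequence. -/
def resolution (hu : ∀ r, u * r = 0 → r = 0) (ha : ∀ r, a * r = 0 → r = 0)
    (hab : ∀ r, a ∣ b * r → a ∣ r) :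
    ProjectiveResolution (ModuleCat.of R (R ⧸ ideal u a b)) where
  complex := resComplex u a b
  π := resπ u a b
  quasiIso := quasiIso_resπ hu ha hab

variable (u a b) in
/-- The components of a lift of `R/(uxay, uxbz) → R/(ua, ub)` to the free resolutions. -/
def liftF (x y z : R) : ∀ n, resX (R := R) n ⟶ resX n
  | 0 => 𝟙 _
  | 1 => ModuleCat.ofHom (((x * y) • LinearMap.id).prodMap ((x * z) • LinearMap.id))
  | 2 => ModuleCat.ofHom ((x * y * z) • LinearMap.id)
  | _ + 3 => 𝟙 _

variable (u a b) in
lemma liftF_comm (x y z : R) : ∀ n,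
    liftF x y z (n + 1) ≫ resD u a b n = resD (u * x) (a * y) (b * z) n ≫ liftF x y z n
  | 0 => by
    have h (p : R × R) :
        d₁ u a b (x * y * p.1, x * z * p.2) = d₁ (u * x) (a * y) (b * z) p := by
      simp only [d₁_apply]
      ring
    exact ModuleCat.hom_ext (LinearMap.ext h)
  | 1 => by
    have h (r : R) : d₂ a b (x * y * z * r) =
        (x * y * (d₂ (a * y) (b * z) r).1, x * z * (d₂ (a * y) (b * z) r).2) := by
      simp only [d₂_apply]
      ext <;> ring
    exact ModuleCat.hom_ext (LinearMap.ext h)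
  | _ + 2 => Limits.comp_zero.trans Limits.zero_comp.symm

variable (u a b) in
def lift (x y z : R) : resComplex (u * x) (a * y) (b * z) ⟶ resComplex u a b :=
  ChainComplex.ofHom (liftF x y z) fun n => by
    rw [resComplex_d, resComplex_d]
    exact liftF_comm u a b x y z n


section
variable (hu : ∀ r, u * r = 0 → r = 0) (ha : ∀ r, a * r = 0 → r = 0)
    (hab : ∀ r, a ∣ b * r → a ∣ r)

abbrev ExtR (n : ℕ) (J : Ideal R) (M : ModuleCat.{u} R) : ModuleCat.{u} R :=
  ((Ext R (ModuleCat.{u} R) n).obj (Opposite.op (ModuleCat.of R (R ⧸ J)))).obj M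

def cocyclesTwo (M : ModuleCat.{u} R) : M →ₗ[R] (resX (R := R) 2 ⟶ M) :=
  (ModuleCat.homLinearEquiv (S := R) (M := ModuleCat.of R R) (N := M)).symm.toLinearMap ∘ₗ
    (LinearMap.ringLmapEquivSelf R R M).symm.toLinearMap

lemma cocyclesTwo_apply (M : ModuleCat.{u} R) (m : M) (r : R) :
    (cocyclesTwo M m).hom r = r • m := rfl

variable (a b) in
def cocyclesOne : R →ₗ[R] (resX (R := R) 1 ⟶ ModuleCat.of R R) :=
  (ModuleCat.homLinearEquiv (S := R) (M := ModuleCat.of R (R × R))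
    (N := ModuleCat.of R R)).symm.toLinearMap ∘ₗ
      LinearMap.toSpanSingleton R _ (d₁ 1 a b)

lemma cocyclesOne_apply (m : R) (r : R × R) :
    (cocyclesOne a b m).hom r = m * (a * r.1 + b * r.2) := by
  change m • d₁ 1 a b r = _
  rw [d₁_apply, one_mul, smul_eq_mul]

def cocyclesTwoLift (M : ModuleCat.{u} R) : M →ₗ[R] (resolution hu ha hab).extCocycles 2 M :=
  (resolution hu ha hab).extCocyclesLift (cocyclesTwo M) (fun m => by
      change (resComplex u a b).d 3 2 ≫ _ = 0
      rw [resComplex_d]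
      exact Limits.zero_comp)

def cocyclesOneLift : R →ₗ[R] (resolution hu ha hab).extCocycles 1 (ModuleCat.of R R) :=
  (resolution hu ha hab).extCocyclesLift (cocyclesOne a b) (fun m => by
      change (resComplex u a b).d 2 1 ≫ _ = 0
      rw [resComplex_d]
      have h (r : R) : (cocyclesOne a b m).hom (d₂ a b r) = 0 := by
        refine (cocyclesOne_apply m (d₂ a b r)).trans ?_
        rw [d₂_apply]
        ring
      exact ModuleCat.hom_ext (LinearMap.ext h))

lemma ι_cocyclesTwoLift (M : ModuleCat.{u} R) (m : M) :
    (resolution hu ha hab).extCocyclesι 2 M (cocyclesTwoLift hu ha hab M m) = cocyclesTwo M m :=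
  (resolution hu ha hab).extCocyclesι_lift _ _ _

lemma ι_cocyclesOneLift (r : R) :
    (resolution hu ha hab).extCocyclesι 1 _ (cocyclesOneLift hu ha hab r) = cocyclesOne a b r :=
  (resolution hu ha hab).extCocyclesι_lift _ _ _

/-- The projection of `M` onto `Ext²(R/(ua, ub), M)`. -/
def extTwo (M : ModuleCat.{u} R) : M →ₗ[R] ExtR 2 (ideal u a b) M :=
  ((resolution hu ha hab).extClass 2 M).hom ∘ₗ cocyclesTwoLift hu ha hab M

/-- The projection of `R` onto `Ext¹(R/(ua, ub), R)`. -/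
def extOne : R →ₗ[R] ExtR 1 (ideal u a b) (ModuleCat.of R R) :=
  ((resolution hu ha hab).extClass 1 _).hom ∘ₗ cocyclesOneLift hu ha hab

lemma extTwo_surjective (M : ModuleCat.{u} R) : Function.Surjective (extTwo hu ha hab M) := by
  refine ((resolution hu ha hab).extClass_surjective 2 M).comp fun c => ?_
  let φ : ModuleCat.of R R ⟶ M := (resolution hu ha hab).extCocyclesι 2 M c
  refine ⟨φ.hom 1, (resolution hu ha hab).extCocyclesι_injective 2 M ?_⟩
  refine (ι_cocyclesTwoLift hu ha hab M _).trans ?_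
  refine ModuleCat.hom_ext (LinearMap.ext_ring ?_)
  exact (cocyclesTwo_apply M _ 1).trans (one_smul _ _)

lemma extTwo_eq_zero_iff (M : ModuleCat.{u} R) (m : M) :
    extTwo hu ha hab M m = 0 ↔ ∃ m₁ m₂ : M, m = a • m₁ + b • m₂ := by
  refine ((resolution hu ha hab).extClass_eq_zero_iff 1 M _).trans ?_
  rw [ι_cocyclesTwoLift]
  change (∃ ψ : resX 1 ⟶ M, cocyclesTwo M m = (resComplex u a b).d 2 1 ≫ ψ) ↔ _
  rw [resComplex_d]
  constructor
  · rintro ⟨ψ, hψ⟩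
    let ψ' : R × R →ₗ[R] M := ψ.hom
    have h1 : m = ψ' (d₂ a b 1) :=
      (one_smul R m).symm.trans (congrArg (fun g => ModuleCat.Hom.hom g (1 : R)) hψ)
    refine ⟨-ψ' (0, 1), ψ' (1, 0), ?_⟩
    rw [h1, d₂_apply, ← map_neg, ← map_smul, ← map_smul, ← map_add]
    congr 1
    ext <;> simp
  · rintro ⟨m₁, m₂, rfl⟩
    refine ⟨ModuleCat.ofHom ((LinearMap.toSpanSingleton R M m₂).coprod
      (-LinearMap.toSpanSingleton R M m₁)), ModuleCat.hom_ext (LinearMap.ext_ring ?_)⟩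
    have h : a • m₁ + b • m₂ = ((LinearMap.toSpanSingleton R M m₂).coprod
        (-LinearMap.toSpanSingleton R M m₁)) (d₂ a b 1) := by
      rw [d₂_apply, LinearMap.coprod_apply, LinearMap.neg_apply, LinearMap.toSpanSingleton_apply,
        LinearMap.toSpanSingleton_apply, mul_one, mul_one, neg_smul, neg_neg, add_comm]
    exact (one_smul R _).trans h

lemma extOne_surjective : Function.Surjective (extOne hu ha hab) := by
  refine ((resolution hu ha hab).extClass_surjective 1 _).comp fun c => ?_
  let φ : R × R →ₗ[R] R := ((resolution hu ha hab).extCocyclesι 1 _ c).hom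
  have hφ : φ ∘ₗ d₂ a b = 0 := by
    have h := (resolution hu ha hab).d_comp_extCocyclesι c
    change (resComplex u a b).d 2 1 ≫ _ = 0 at h
    rw [resComplex_d] at h
    exact congrArg ModuleCat.Hom.hom h
  have hφ' (p q : R) : φ (p, q) = φ (1, 0) * p + φ (0, 1) * q := by
    rw [mul_comm, mul_comm _ q, ← smul_eq_mul, ← smul_eq_mul, ← map_smul, ← map_smul, ← map_add]
    congr 1
    ext <;> simp
  have h1 : φ (1, 0) * b = φ (0, 1) * a := by
    have h := congrArg (fun g : R →ₗ[R] R => g 1) hφ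
    simp only [LinearMap.comp_apply, d₂_apply, LinearMap.zero_apply] at h
    rw [hφ'] at h
    linear_combination h
  obtain ⟨r, hr⟩ := hab (φ (1, 0)) ⟨φ (0, 1), by linear_combination h1⟩
  have h2 : φ (0, 1) = b * r := by
    rw [← sub_eq_zero]
    refine ha _ ?_
    linear_combination b * hr - h1
  refine ⟨r, (resolution hu ha hab).extCocyclesι_injective 1 _ ?_⟩
  refine (ι_cocyclesOneLift hu ha hab _).trans ?_
  have h (p : R × R) : (cocyclesOne a b r).hom p = φ (p.1, p.2) := by
    refine (cocyclesOne_apply r p).trans ?_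
    rw [hφ', hr, h2]
    ring
  exact ModuleCat.hom_ext (LinearMap.ext h)

lemma extOne_eq_zero_iff (r : R) : extOne hu ha hab r = 0 ↔ u ∣ r := by
  refine ((resolution hu ha hab).extClass_eq_zero_iff 0 _ _).trans ?_
  rw [ι_cocyclesOneLift]
  change (∃ ψ : resX 0 ⟶ _, cocyclesOne a b r = (resComplex u a b).d 1 0 ≫ ψ) ↔ _
  rw [resComplex_d]
  constructor
  · rintro ⟨ψ, hψ⟩
    let ψ' : R →ₗ[R] R := ψ.hom
    refine ⟨ψ' 1, ?_⟩
    have h1 : r * (a * 1 + b * 0) = ψ' (d₁ u a b (1, 0)) :=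
      (cocyclesOne_apply r (1, 0)).symm.trans
        (congrArg (fun g => ModuleCat.Hom.hom g ((1, 0) : R × R)) hψ)
    have h2 : ψ' (d₁ u a b (1, 0)) = u * a * ψ' 1 := by
      rw [d₁_apply, ← smul_eq_mul (u * a), ← map_smul]
      simp
    rw [← sub_eq_zero]
    refine ha _ ?_
    linear_combination h1 + h2
  · rintro ⟨s, rfl⟩
    have h (p : R × R) : (cocyclesOne a b (u * s)).hom p = s * d₁ u a b p := by
      refine (cocyclesOne_apply _ p).trans ?_
      rw [d₁_apply]
      ring
    let ψ : resX (R := R) 0 ⟶ ModuleCat.of R R := ModuleCat.ofHom (s • LinearMap.id : R →ₗ[R] R)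
    have h' : cocyclesOne a b (u * s) = resD u a b 0 ≫ ψ := ModuleCat.hom_ext (LinearMap.ext h)
    exact ⟨ψ, h'⟩

variable {x y z u' a' b' : R} (hu' : ∀ r, u' * r = 0 → r = 0) (ha' : ∀ r, a' * r = 0 → r = 0)
    (hab' : ∀ r, a' ∣ b' * r → a' ∣ r)
    (f : ModuleCat.of R (R ⧸ ideal u' a' b') ⟶ ModuleCat.of R (R ⧸ ideal u a b))
    (hf : ∀ r : R, f.hom (Submodule.Quotient.mk r) = Submodule.Quotient.mk r)

lemma lift_comm
    (hu' : ∀ r, u * x * r = 0 → r = 0) (ha' : ∀ r, a * y * r = 0 → r = 0)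
    (hab' : ∀ r, a * y ∣ b * z * r → a * y ∣ r)
    (f : ModuleCat.of R (R ⧸ ideal (u * x) (a * y) (b * z)) ⟶ ModuleCat.of R (R ⧸ ideal u a b))
    (hf : ∀ r : R, f.hom (Submodule.Quotient.mk r) = Submodule.Quotient.mk r) :
    (lift u a b x y z).f 0 ≫ (resolution hu ha hab).π.f 0 =
      (resolution hu' ha' hab').π.f 0 ≫ f := by
  change 𝟙 _ ≫ (resπ u a b).f 0 = (resπ (u * x) (a * y) (b * z)).f 0 ≫ f
  rw [resπ_f_zero, resπ_f_zero]
  exact ModuleCat.hom_ext (LinearMap.ext fun r => (hf r).symm)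

include hf in
lemma map_extTwo (hux : u' = u * x) (hay : a' = a * y) (hbz : b' = b * z)
    (M : ModuleCat.{u} R) (m : M) :
    ((Ext R (ModuleCat.{u} R) 2).map f.op).app M (extTwo hu ha hab M m) =
      extTwo hu' ha' hab' M ((x * y * z) • m) := by
  subst hux hay hbz
  refine (resolution hu ha hab).extClass_naturality 2 M (resolution hu' ha' hab') f
    (lift u a b x y z) (lift_comm hu ha hab hu' ha' hab' f hf) _ _ ?_
  rw [ι_cocyclesTwoLift, ι_cocyclesTwoLift]
  refine ModuleCat.hom_ext (LinearMap.ext_ring ?_)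
  change (1 : R) • _ = (x * y * z * 1) • m
  rw [one_smul, mul_one]

include hf in
lemma map_extOne (hux : u' = u * x) (hay : a' = a * y) (hbz : b' = b * z)
    (m : R) :
    ((Ext R (ModuleCat.{u} R) 1).map f.op).app _ (extOne hu ha hab m) =
      extOne hu' ha' hab' (x * m) := by
  subst hux hay hbz
  refine (resolution hu ha hab).extClass_naturality 1 _ (resolution hu' ha' hab') f
    (lift u a b x y z) (lift_comm hu ha hab hu' ha' hab' f hf) _ _ ?_
  rw [ι_cocyclesOneLift, ι_cocyclesOneLift]
  have h (p : R × R) : (cocyclesOne (a * y) (b * z) (x * m)).hom p =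
      (cocyclesOne a b m).hom (x * y * p.1, x * z * p.2) := by
    rw [cocyclesOne_apply, cocyclesOne_apply]
    ring
  exact ModuleCat.hom_ext (LinearMap.ext h)
end

end TwoGenerated

end

namespace CategoryTheory
open Limits

section
variable {R : Type u} [CommRing R]

instance preservesLimits_linearYoneda (M : ModuleCat.{u} R) :
    PreservesLimits ((linearYoneda R (ModuleCat.{u} R)).obj M) :=
  have : PreservesLimits ((linearYoneda R (ModuleCat.{u} R)).obj M ⋙ forget _) :=
    inferInstanceAs (PreservesLimits (yoneda.obj M))
  preservesLimits_of_reflects_of_preserves _ (forget _)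

/-- `Ext⁰(N, M)` is `Hom(N, M)`. -/
def extZeroIso (N M : ModuleCat.{u} R) :
    ((Ext R (ModuleCat.{u} R) 0).obj (Opposite.op N)).obj M ≅ ModuleCat.of R (N ⟶ M) :=
  have := preservesFiniteColimits_rightOp ((linearYoneda R (ModuleCat.{u} R)).obj M)
  (((linearYoneda R (ModuleCat.{u} R)).obj M).rightOp.leftDerivedZeroIsoSelf.symm.app N).unop

end
end CategoryTheory

namespace localCohomology
open Limits Opposite

section
variable {R : Type u} [CommRing R] {J : Ideal R}

lemma exists_map_eq_zero_of_isColimit {D : Type} [SmallCategory D] [IsFiltered D]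
    {F : D ⥤ ModuleCat.{u} R} {c : Cocone F} (hc : IsColimit c) {j : D} (e : F.obj j)
    (he : c.ι.app j e = 0) : ∃ s, ∃ f : j ⟶ s, F.map f e = 0 := by
  have : PreservesFilteredColimitsOfSize.{0, 0} (forget (ModuleCat.{u} R)) :=
    preservesFilteredColimitsOfSize_shrink.{0, u, 0, u} _
  obtain ⟨s, f, g, h⟩ := Concrete.isColimit_exists_of_rep_eq _ hc e (0 : F.obj j)
    (he.trans (map_zero (c.ι.app j).hom).symm)
  exact ⟨s, f, h.trans (map_zero (F.map g).hom)⟩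

/-- A descending sequence of ideals, as a diagram. -/
abbrev antitoneDiagram {K : ℕ → Ideal R} (hK : Antitone K) : ℕᵒᵖ ⥤ Ideal R where
  obj t := K t.unop
  map w := homOfLE (hK w.unop.le)

variable {K : ℕ → Ideal R} (hK : Antitone K)

abbrev antitoneToSelfLERadical (hJ : ∀ t, J ≤ (K t).radical) : ℕᵒᵖ ⥤ SelfLERadical J :=
  ObjectProperty.lift _ (antitoneDiagram hK) fun t => hJ t.unop

lemma initial_antitoneToSelfLERadical [IsNoetherianRing R] (hJ : ∀ t, J ≤ (K t).radical)
    (hKJ : ∀ t, K t ≤ J ^ t) : (antitoneToSelfLERadical hK hJ).Initial where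
  out J' := by
    apply +allowSynthFailures zigzag_isConnected
    · obtain ⟨k, hk⟩ := Ideal.exists_pow_le_of_le_radical_of_fg J'.2 (IsNoetherian.noetherian J)
      exact ⟨CostructuredArrow.mk
        (⟨⟨⟨(hKJ k).trans hk⟩⟩⟩ : (antitoneToSelfLERadical hK hJ).obj (op k) ⟶ J')⟩
    · intro j1 j2
      apply Relation.ReflTransGen.single
      rcases le_total (unop j1.left) (unop j2.left) with h | h
      · right; exact ⟨CostructuredArrow.homMk (homOfLE h).op rfl⟩
      · left; exact ⟨CostructuredArrow.homMk (homOfLE h).op rfl⟩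

/-- Local cohomology computed by a sequence of ideals cofinal with the powers of `J`. -/
def isoOfAntitone [IsNoetherianRing R] (hJ : ∀ t, J ≤ (K t).radical) (hKJ : ∀ t, K t ≤ J ^ t)
    (i : ℕ) : colimit (diagram (antitoneDiagram hK) i) ≅ localCohomology J i :=
  have := initial_antitoneToSelfLERadical hK hJ hKJ
  HasColimit.isoOfNatIso (Iso.refl _) ≪≫ isoOfFinal.{u, u, 0} (antitoneToSelfLERadical hK hJ)
    (selfLERadicalDiagram J) i ≪≫ isoSelfLERadical J i

variable [IsNoetherianRing R] (hJ : ∀ t, J ≤ (K t).radical) (hKJ : ∀ t, K t ≤ J ^ t)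
  (i : ℕ) (M : ModuleCat.{u} R)

/-- The colimit cocone with point the local cohomology of `M`. -/
abbrev antitoneCocone : Cocone (diagram (antitoneDiagram hK) i ⋙ (evaluation _ _).obj M) :=
  (((evaluation _ _).obj M).mapCocone (colimit.cocone (diagram (antitoneDiagram hK) i))).extend
    ((isoOfAntitone hK hJ hKJ i).hom.app M)

def isColimitAntitoneCocone : IsColimit (antitoneCocone hK hJ hKJ i M) :=
  IsColimit.extendIso (s := ((evaluation _ _).obj M).mapCocone
      (colimit.cocone (diagram (antitoneDiagram hK) i)))
    ((isoOfAntitone hK hJ hKJ i).hom.app M)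
    (isColimitOfPreserves ((evaluation _ _).obj M) (colimit.isColimit _))

/-- The structure map from `Extⁱ(R/Kₜ, M)` to the local cohomology of `M`. -/
def ofExt (t : ℕ) : ((Ext R (ModuleCat.{u} R) i).obj (op (ModuleCat.of R (R ⧸ K t)))).obj M ⟶
    (localCohomology J i).obj M :=
  (antitoneCocone hK hJ hKJ i M).ι.app (op (op t))

abbrev factor {t s : ℕ} (h : t ≤ s) : ModuleCat.of R (R ⧸ K s) ⟶ ModuleCat.of R (R ⧸ K t) :=
  (ringModIdeals (antitoneDiagram hK)).map (homOfLE h).op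

lemma ofExt_map {t s : ℕ} (h : t ≤ s) (e) :
    ofExt hK hJ hKJ i M s (((Ext R (ModuleCat.{u} R) i).map (factor hK h).op).app M e) =
      ofExt hK hJ hKJ i M t e :=
  ConcreteCategory.congr_hom ((antitoneCocone hK hJ hKJ i M).w (homOfLE h).op.op) e

lemma exists_ofExt_eq (m : (localCohomology J i).obj M) : ∃ t e, ofExt hK hJ hKJ i M t e = m := by
  have : PreservesFilteredColimitsOfSize.{0, 0} (forget (ModuleCat.{u} R)) :=
    preservesFilteredColimitsOfSize_shrink.{0, u, 0, u} _
  obtain ⟨t, e, he⟩ := Concrete.isColimit_exists_rep _ (isColimitAntitoneCocone hK hJ hKJ i M) m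
  exact ⟨t.unop.unop, e, he⟩

lemma exists_map_eq_zero {t : ℕ} (e) (he : ofExt hK hJ hKJ i M t e = 0) :
    ∃ s, ∃ h : t ≤ s, ((Ext R (ModuleCat.{u} R) i).map (factor hK h).op).app M e = 0 := by
  obtain ⟨s, f, h⟩ := exists_map_eq_zero_of_isColimit (isColimitAntitoneCocone hK hJ hKJ i M)
    (j := op (op t)) e he
  exact ⟨s.unop.unop, f.unop.unop.le, h⟩

end
end localCohomology

/-- `x, y, z` behave like part of a regular system of parameters. -/
structure PrimeTriple {R : Type u} [CommRing R] (x y z : R) : Prop where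
  ne_zero : x ≠ 0
  prime_y : Prime y
  prime_z : Prime z
  not_dvd : ¬ y ∣ z
  isPrime : (Ideal.span {y, z}).IsPrime
  notMem : x ∉ Ideal.span {y, z}

namespace PrimeTriple
open TwoGenerated localCohomology

variable {R : Type u} [CommRing R] {x y z : R} (h : PrimeTriple x y z)

include h in
lemma inf_eq : Ideal.span {x} ⊓ Ideal.span {y, z} = ideal x y z := by
  apply le_antisymm
  · rintro v ⟨h1, h2⟩
    obtain ⟨w, rfl⟩ := Ideal.mem_span_singleton.mp h1
    obtain ⟨p, q, hw⟩ := Ideal.mem_span_pair.mp ((h.isPrime.mem_or_mem h2).resolve_left h.notMem)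
    exact Ideal.mem_span_pair.mpr ⟨p, q, by rw [← hw]; ring⟩
  · refine Ideal.span_le.mpr ?_
    rintro _ (rfl | rfl)
    · exact ⟨Ideal.mul_mem_right _ _ (Ideal.mem_span_singleton_self x),
        Ideal.mul_mem_left _ _ (Ideal.subset_span (by simp))⟩
    · exact ⟨Ideal.mul_mem_right _ _ (Ideal.mem_span_singleton_self x),
        Ideal.mul_mem_left _ _ (Ideal.subset_span (by simp))⟩

include h in
lemma pow_notMem (j : ℕ) : x ^ j ∉ Ideal.span {y, z} := fun hj =>
  h.notMem (h.isPrime.mem_of_pow_mem j hj)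

include h in
lemma pow_ne (hx : x ∈ Ideal.jacobson (⊥ : Ideal R)) (s : ℕ) (p q r : R) :
    x ^ s ≠ x ^ (s + 1) * p + y * q + z * r := by
  intro he
  obtain ⟨w, hw⟩ := isUnit_iff_exists_inv.mp (Ideal.mem_jacobson_bot.mp hx (-p))
  refine h.pow_notMem s (Ideal.mem_span_pair.mpr ⟨q * w, r * w, ?_⟩)
  linear_combination x ^ s * hw - w * he

variable (x y z) in
/-- The ideals `(xᵗyᵗ, xᵗzᵗ)`. -/
abbrev powIdeal (t : ℕ) : Ideal R := ideal (x ^ t) (y ^ t) (z ^ t)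

variable (x y z) in
lemma antitone_powIdeal : Antitone (powIdeal x y z) := by
  intro t s hts
  obtain ⟨k, rfl⟩ := Nat.exists_eq_add_of_le hts
  refine Ideal.span_le.mpr ?_
  rintro _ (rfl | rfl)
  · exact Ideal.mem_span_pair.mpr ⟨x ^ k * y ^ k, 0, by ring⟩
  · exact Ideal.mem_span_pair.mpr ⟨0, x ^ k * z ^ k, by ring⟩

variable (x y z) in
lemma le_radical_powIdeal (t : ℕ) : ideal x y z ≤ (powIdeal x y z t).radical := by
  refine Ideal.span_le.mpr ?_
  rintro _ (rfl | rfl)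
  · exact ⟨t, Ideal.mem_span_pair.mpr ⟨1, 0, by ring⟩⟩
  · exact ⟨t, Ideal.mem_span_pair.mpr ⟨0, 1, by ring⟩⟩

variable (x y z) in
lemma powIdeal_le_pow (t : ℕ) : powIdeal x y z t ≤ ideal x y z ^ t := by
  refine Ideal.span_le.mpr ?_
  rintro _ (rfl | rfl)
  · rw [← mul_pow]
    exact Ideal.pow_mem_pow (Ideal.subset_span (by simp)) t
  · rw [← mul_pow]
    exact Ideal.pow_mem_pow (Ideal.subset_span (by simp)) t

variable [IsDomain R]

include h in
lemma not_dvd' : ¬ z ∣ y := fun hd =>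
  h.not_dvd ((h.prime_z.irreducible.dvd_comm h.prime_y.irreducible).mp hd)

include h in
lemma pow_mul_pow_ne (j t : ℕ) (p q : R) :
    x ^ j * (y * z) ^ t ≠ y ^ (t + 1) * p + z ^ (t + 1) * q := by
  intro he
  obtain ⟨q', rfl⟩ : y ^ t ∣ q := by
    refine h.prime_y.pow_dvd_of_dvd_mul_left t (fun hd => h.not_dvd (h.prime_y.dvd_of_dvd_pow hd))
      (a := z ^ (t + 1)) ⟨x ^ j * z ^ t - y * p, ?_⟩
    linear_combination -he
  have h1 : x ^ j * z ^ t = y * p + z ^ (t + 1) * q' := by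
    refine mul_left_cancel₀ (pow_ne_zero t h.prime_y.ne_zero) ?_
    linear_combination he
  obtain ⟨p', rfl⟩ : z ^ t ∣ p := by
    refine h.prime_z.pow_dvd_of_dvd_mul_left t h.not_dvd' (a := y) ⟨x ^ j - z * q', ?_⟩
    linear_combination -h1
  refine h.pow_notMem j (Ideal.mem_span_pair.mpr ⟨p', q', ?_⟩)
  refine mul_left_cancel₀ (pow_ne_zero t h.prime_z.ne_zero) ?_
  linear_combination -h1

include h in
lemma pow_x_regular (t : ℕ) (r : R) (hr : x ^ t * r = 0) : r = 0 :=
  (mul_eq_zero.mp hr).resolve_left (pow_ne_zero t h.ne_zero)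

include h in
lemma pow_y_regular (t : ℕ) (r : R) (hr : y ^ t * r = 0) : r = 0 :=
  (mul_eq_zero.mp hr).resolve_left (pow_ne_zero t h.prime_y.ne_zero)

include h in
lemma pow_dvd_of_pow_dvd_mul (t : ℕ) (r : R) (hr : y ^ t ∣ z ^ t * r) : y ^ t ∣ r :=
  h.prime_y.pow_dvd_of_dvd_mul_left t (fun hd => h.not_dvd (h.prime_y.dvd_of_dvd_pow hd)) hr

variable (x y z) in
/-- The transition maps of the system `Extⁱ(R/(xᵗyᵗ, xᵗzᵗ), R)`. -/
def transition (i t k : ℕ) : ExtR i (powIdeal x y z t) (ModuleCat.of R R) ⟶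
    ExtR i (powIdeal x y z (t + k)) (ModuleCat.of R R) :=
  ((Ext R (ModuleCat.{u} R) i).map
    (factor (antitone_powIdeal x y z) (Nat.le_add_right t k)).op).app (ModuleCat.of R R)

/-- The projection from `R` onto `Ext²(R/(xᵗyᵗ, xᵗzᵗ), R)`. -/
def powTwo (t : ℕ) : R →ₗ[R] ExtR 2 (powIdeal x y z t) (ModuleCat.of R R) :=
  extTwo (h.pow_x_regular t) (h.pow_y_regular t) (h.pow_dvd_of_pow_dvd_mul t) (ModuleCat.of R R)

/-- The projection from `R` onto `Ext¹(R/(xᵗyᵗ, xᵗzᵗ), R)`. -/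
def powOne (t : ℕ) : R →ₗ[R] ExtR 1 (powIdeal x y z t) (ModuleCat.of R R) :=
  extOne (h.pow_x_regular t) (h.pow_y_regular t) (h.pow_dvd_of_pow_dvd_mul t)

lemma powTwo_eq_zero_iff (t : ℕ) (r : R) :
    h.powTwo t r = 0 ↔ ∃ p q, r = y ^ t * p + z ^ t * q :=
  extTwo_eq_zero_iff (h.pow_x_regular t) (h.pow_y_regular t) (h.pow_dvd_of_pow_dvd_mul t)
    (ModuleCat.of R R) r

lemma powOne_eq_zero_iff (t : ℕ) (r : R) : h.powOne t r = 0 ↔ x ^ t ∣ r :=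
  extOne_eq_zero_iff (h.pow_x_regular t) (h.pow_y_regular t) (h.pow_dvd_of_pow_dvd_mul t) r

lemma powOne_surjective (t : ℕ) : Function.Surjective (h.powOne t) :=
  extOne_surjective (h.pow_x_regular t) (h.pow_y_regular t) (h.pow_dvd_of_pow_dvd_mul t)

lemma transition_powTwo (t k : ℕ) (r : R) :
    transition x y z 2 t k (h.powTwo t r) = h.powTwo (t + k) (x ^ k * y ^ k * z ^ k * r) :=
  map_extTwo (h.pow_x_regular t) (h.pow_y_regular t) (h.pow_dvd_of_pow_dvd_mul t)
    (h.pow_x_regular (t + k)) (h.pow_y_regular (t + k)) (h.pow_dvd_of_pow_dvd_mul (t + k))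
    (factor (antitone_powIdeal x y z) (Nat.le_add_right t k)) (fun _ => rfl)
    (pow_add x t k) (pow_add y t k) (pow_add z t k) (ModuleCat.of R R) r

lemma transition_powOne (t k : ℕ) (r : R) :
    transition x y z 1 t k (h.powOne t r) = h.powOne (t + k) (x ^ k * r) :=
  map_extOne (h.pow_x_regular t) (h.pow_y_regular t) (h.pow_dvd_of_pow_dvd_mul t)
    (h.pow_x_regular (t + k)) (h.pow_y_regular (t + k)) (h.pow_dvd_of_pow_dvd_mul (t + k))
    (factor (antitone_powIdeal x y z) (Nat.le_add_right t k)) (fun _ => rfl)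
    (pow_add x t k) (pow_add y t k) (pow_add z t k) r

variable [IsNoetherianRing R]

variable (x y z) in
/-- The local cohomology of `R` with support in `x (y, z)`. -/
abbrev H (i : ℕ) : ModuleCat.{u} R :=
  (localCohomology (ideal x y z) i).obj (ModuleCat.of R R)

variable (x y z) in
/-- The structure map `Extⁱ(R/(xᵗyᵗ, xᵗzᵗ), R) → Hⁱ(R)`. -/
def ofPow (i t : ℕ) : ExtR i (powIdeal x y z t) (ModuleCat.of R R) ⟶ H x y z i :=
  ofExt (antitone_powIdeal x y z) (le_radical_powIdeal x y z) (powIdeal_le_pow x y z) i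
    (ModuleCat.of R R) t

omit [IsDomain R] in
lemma ofPow_transition (i t k : ℕ) (e : ExtR i (powIdeal x y z t) (ModuleCat.of R R)) :
    ofPow x y z i (t + k) (transition x y z i t k e) = ofPow x y z i t e :=
  ofExt_map (antitone_powIdeal x y z) (le_radical_powIdeal x y z) (powIdeal_le_pow x y z) i
    (ModuleCat.of R R) (Nat.le_add_right t k) e

omit [IsDomain R] in
lemma exists_ofPow_eq {i : ℕ} (m : H x y z i) : ∃ t e, ofPow x y z i t e = m :=
  exists_ofExt_eq (antitone_powIdeal x y z) (le_radical_powIdeal x y z) (powIdeal_le_pow x y z) i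
    (ModuleCat.of R R) m

omit [IsDomain R] in
lemma exists_transition_eq_zero {i t : ℕ} (e : ExtR i (powIdeal x y z t) (ModuleCat.of R R))
    (he : (ofPow x y z i t).hom e = 0) : ∃ k, (transition x y z i t k).hom e = 0 := by
  obtain ⟨s, hs, he⟩ := exists_map_eq_zero (antitone_powIdeal x y z) (le_radical_powIdeal x y z)
    (powIdeal_le_pow x y z) i (ModuleCat.of R R) e he
  obtain ⟨k, rfl⟩ := Nat.exists_eq_add_of_le hs
  exact ⟨k, he⟩

/-- The map `R → Ext²(R/(xᵗyᵗ, xᵗzᵗ), R) → H²(R)`. -/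
def toH2 (t : ℕ) : R →ₗ[R] H x y z 2 := (ofPow x y z 2 t).hom ∘ₗ h.powTwo t

/-- The map `R → Ext¹(R/(xᵗyᵗ, xᵗzᵗ), R) → H¹(R)`. -/
def toH1 (t : ℕ) : R →ₗ[R] H x y z 1 := (ofPow x y z 1 t).hom ∘ₗ h.powOne t

lemma toH2_apply (t : ℕ) (r : R) : h.toH2 t r = (ofPow x y z 2 t).hom (h.powTwo t r) := rfl

lemma toH1_apply (t : ℕ) (r : R) : h.toH1 t r = (ofPow x y z 1 t).hom (h.powOne t r) := rfl

lemma toH2_add (t k : ℕ) (r : R) :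
    h.toH2 (t + k) (x ^ k * y ^ k * z ^ k * r) = h.toH2 t r := by
  refine (congrArg (ofPow x y z 2 (t + k)) (h.transition_powTwo t k r).symm).trans ?_
  exact ofPow_transition 2 t k (h.powTwo t r)

lemma toH1_add (t k : ℕ) (r : R) : h.toH1 (t + k) (x ^ k * r) = h.toH1 t r := by
  refine (congrArg (ofPow x y z 1 (t + k)) (h.transition_powOne t k r).symm).trans ?_
  exact ofPow_transition 1 t k (h.powOne t r)

lemma exists_of_toH2_eq_zero {t : ℕ} {r : R} (hr : h.toH2 t r = 0) :
    ∃ k p q, x ^ k * y ^ k * z ^ k * r = y ^ (t + k) * p + z ^ (t + k) * q := by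
  obtain ⟨k, he⟩ := exists_transition_eq_zero (i := 2) (t := t) (h.powTwo t r)
    (((h.toH2_apply t r).symm.trans hr :))
  exact ⟨k, (h.powTwo_eq_zero_iff _ _).mp ((h.transition_powTwo t k r).symm.trans he)⟩

lemma exists_of_toH1_eq_zero {t : ℕ} {r : R} (hr : h.toH1 t r = 0) :
    ∃ k, x ^ (t + k) ∣ x ^ k * r := by
  obtain ⟨k, he⟩ := exists_transition_eq_zero (i := 1) (t := t) (h.powOne t r)
    (((h.toH1_apply t r).symm.trans hr :))
  exact ⟨k, (h.powOne_eq_zero_iff _ _).mp ((h.transition_powOne t k r).symm.trans he)⟩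

lemma exists_toH1_eq (m : H x y z 1) : ∃ t r, h.toH1 t r = m := by
  obtain ⟨t, e, he⟩ := exists_ofPow_eq m
  obtain ⟨r, rfl⟩ := h.powOne_surjective t e
  exact ⟨t, r, he⟩

end PrimeTriple

namespace PrimeTriple
open TwoGenerated localCohomology

section
variable {R : Type u} [CommRing R] [IsDomain R] [IsNoetherianRing R] {x y z : R}
  (h : PrimeTriple x y z)

lemma smul_toH2_succ (n : ℕ) :
    x • h.toH2 (n + 1 + 1) ((y * z) ^ (n + 1)) = h.toH2 (n + 1) ((y * z) ^ n) := by
  rw [← h.toH2_add (n + 1) 1, ← map_smul, smul_eq_mul]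
  congr 1
  ring

lemma smul_toH2_eq_zero (n : ℕ) {v : R} (hv : v ∈ ideal x y z) :
    v • h.toH2 (n + 1) ((y * z) ^ n) = 0 := by
  obtain ⟨p, q, rfl⟩ := Ideal.mem_span_pair.mp hv
  rw [← map_smul, smul_eq_mul, toH2_apply,
    (h.powTwo_eq_zero_iff _ _).mpr ⟨p * x * z ^ n, q * x * y ^ n, by ring⟩, map_zero]

lemma toH2_one_ne_zero : h.toH2 1 1 ≠ 0 := by
  intro h0
  obtain ⟨k, p, q, he⟩ := h.exists_of_toH2_eq_zero h0
  refine h.pow_mul_pow_ne k k p q ?_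
  rw [add_comm k 1, ← he]
  ring

/-- The homomorphism `R/I → H²(R)` defined by the class of `(yz)ⁿ`. -/
def homH2 (n : ℕ) : (R ⧸ ideal x y z) →ₗ[R] H x y z 2 :=
  (ideal x y z).liftQ (LinearMap.toSpanSingleton R _ (h.toH2 (n + 1) ((y * z) ^ n)))
    fun _ hv => LinearMap.mem_ker.mpr (h.smul_toH2_eq_zero n hv)

lemma homH2_mk_one (n : ℕ) :
    h.homH2 n (Submodule.Quotient.mk 1) = h.toH2 (n + 1) ((y * z) ^ n) :=
  one_smul R _

lemma smul_homH2_succ (n : ℕ) : x • h.homH2 (n + 1) = h.homH2 n := by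
  refine Submodule.linearMap_qext _ (LinearMap.ext_ring ?_)
  change x • h.homH2 (n + 1) (Submodule.Quotient.mk 1) = h.homH2 n (Submodule.Quotient.mk 1)
  rw [homH2_mk_one, homH2_mk_one, smul_toH2_succ]

variable (hx : x ∈ Ideal.jacobson (⊥ : Ideal R))

include h hx

lemma not_finite_hom : ¬ Module.Finite R ((R ⧸ ideal x y z) →ₗ[R] H x y z 2) := by
  intro hfin
  have hN : Submodule.span R (Set.range h.homH2) = ⊥ := by
    refine Submodule.eq_bot_of_le_smul_of_le_jacobson_bot (Ideal.span {x}) _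
      (IsNoetherian.noetherian _) (Submodule.span_le.mpr ?_)
      ((Ideal.span_singleton_le_iff_mem _).mpr hx)
    rintro _ ⟨n, rfl⟩
    rw [← h.smul_homH2_succ n]
    exact Submodule.smul_mem_smul (Ideal.mem_span_singleton_self x)
      (Submodule.subset_span ⟨n + 1, rfl⟩)
  have h0 : h.homH2 0 = 0 :=
    (Submodule.mem_bot R).mp (hN ▸ Submodule.subset_span ⟨0, rfl⟩)
  refine h.toH2_one_ne_zero ?_
  have h1 := h.homH2_mk_one 0
  rw [h0, pow_zero] at h1
  exact h1.symm

lemma not_finite_ext_zero : ¬ Module.Finite R (ExtR 0 (ideal x y z) (H x y z 2)) := fun _ =>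
  h.not_finite_hom hx (Module.Finite.equiv
    ((extZeroIso (ModuleCat.of R (R ⧸ ideal x y z)) (H x y z 2)).toLinearEquiv ≪≫ₗ
      ModuleCat.homLinearEquiv))

omit hx in
lemma exists_smul_eq (m : H x y z 1) : ∃ m', x • m' = m := by
  obtain ⟨t, r, rfl⟩ := h.exists_toH1_eq m
  refine ⟨h.toH1 (t + 1) r, ?_⟩
  rw [← h.toH1_add t 1, ← map_smul, pow_one, smul_eq_mul]

lemma toH1_one_ne (m₁ m₂ : H x y z 1) : h.toH1 1 1 ≠ y • m₁ + z • m₂ := by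
  intro he
  obtain ⟨t, r, rfl⟩ := h.exists_toH1_eq m₁
  obtain ⟨s, v, rfl⟩ := h.exists_toH1_eq m₂
  have h1 : h.toH1 (t + s + 1) (x ^ (t + s) - y * (x ^ (s + 1) * r) - z * (x ^ (t + 1) * v)) =
      0 := by
    rw [map_sub, map_sub, ← smul_eq_mul y, ← smul_eq_mul z, map_smul, map_smul,
      add_assoc t s 1, h.toH1_add t (s + 1) r, show t + (s + 1) = s + (t + 1) by omega,
      h.toH1_add s (t + 1) v, sub_sub, ← he, ← h.toH1_add 1 (t + s) 1, mul_one,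
      show s + (t + 1) = 1 + (t + s) by omega, sub_self]
  obtain ⟨k, w, hw⟩ := h.exists_of_toH1_eq_zero h1
  refine h.pow_ne hx (t + s) w (x ^ (s + 1) * r) (x ^ (t + 1) * v) ?_
  refine mul_left_cancel₀ (pow_ne_zero k h.ne_zero) ?_
  linear_combination hw

lemma not_finite_ext_two : ¬ Module.Finite R (ExtR 2 (ideal x y z) (H x y z 1)) := by
  intro hfin
  have hu (r : R) (hr : x * r = 0) : r = 0 := (mul_eq_zero.mp hr).resolve_left h.ne_zero
  have ha (r : R) (hr : y * r = 0) : r = 0 := (mul_eq_zero.mp hr).resolve_left h.prime_y.ne_zero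
  have hab (r : R) (hr : y ∣ z * r) : y ∣ r := (h.prime_y.dvd_or_dvd hr).resolve_left h.not_dvd
  have htop : (⊤ : Submodule R (ExtR 2 (ideal x y z) (H x y z 1))) = ⊥ := by
    refine Submodule.eq_bot_of_le_smul_of_le_jacobson_bot (Ideal.span {x}) _
      hfin.fg_top (fun e _ => ?_) ((Ideal.span_singleton_le_iff_mem _).mpr hx)
    obtain ⟨m, rfl⟩ := extTwo_surjective hu ha hab (H x y z 1) e
    obtain ⟨m', rfl⟩ := h.exists_smul_eq m
    rw [map_smul]
    exact Submodule.smul_mem_smul (Ideal.mem_span_singleton_self x) Submodule.mem_top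
  have h0 : extTwo hu ha hab (H x y z 1) (h.toH1 1 1) = 0 :=
    (Submodule.mem_bot R).mp (htop ▸ Submodule.mem_top)
  obtain ⟨m₁, m₂, he⟩ := (extTwo_eq_zero_iff hu ha hab (H x y z 1) _).mp h0
  exact h.toH1_one_ne hx m₁ m₂ he

end
end PrimeTriple

section
open MvPolynomial
variable (k : Type u) [Field k]

/-- A prime ideal of `k[x,y,z]` contained in `(x,y,z)` extends to a prime ideal of `R13 k`. -/
lemma isPrime_map_R13 {Q : Ideal (MvPolynomial (Fin 3) k)} (hQ : Q.IsPrime) (hQP : Q ≤ P13 k) :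
    (Q.map (algebraMap _ (R13 k))).IsPrime :=
  IsLocalization.isPrime_of_isPrime_disjoint (P13 k).primeCompl _ Q hQ
    (Set.disjoint_left.mpr fun _ hp hq => hp (hQP hq))

lemma algebraMap_mem_map_R13 {Q : Ideal (MvPolynomial (Fin 3) k)} (hQ : Q.IsPrime)
    (hQP : Q ≤ P13 k) {p : MvPolynomial (Fin 3) k}
    (hp : algebraMap _ (R13 k) p ∈ Q.map (algebraMap _ (R13 k))) : p ∈ Q := by
  have h := IsLocalization.under_map_of_isPrime_disjoint (P13 k).primeCompl (R13 k) hQ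
    (Set.disjoint_left.mpr fun _ hp hq => hp (hQP hq))
  exact h ▸ hp

lemma X_mem_P13 (i : Fin 3) : X i ∈ P13 k := by
  refine Ideal.subset_span ?_
  fin_cases i <;> simp

lemma span_X_isPrime (i : Fin 3) : (Ideal.span {(X i : MvPolynomial (Fin 3) k)}).IsPrime :=
  (Ideal.span_singleton_prime (X_ne_zero i)).mpr (X_prime)

lemma span_X_le (i : Fin 3) : Ideal.span {(X i : MvPolynomial (Fin 3) k)} ≤ P13 k :=
  (Ideal.span_singleton_le_iff_mem _).mpr (X_mem_P13 k i)

/-- The ideal `(y,z)` is the kernel of the evaluation at `y = z = 0`. -/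
lemma span_X_pair_eq_ker : Ideal.span {(X 1 : MvPolynomial (Fin 3) k), X 2} =
    RingHom.ker (aeval ![(Polynomial.X : Polynomial k), 0, 0]) := by
  apply le_antisymm
  · refine Ideal.span_le.mpr ?_
    rintro _ (rfl | rfl) <;> simp
  · intro p hp
    have h (p : MvPolynomial (Fin 3) k) : p - Polynomial.aeval (X 0)
        (aeval ![(Polynomial.X : Polynomial k), 0, 0] p) ∈
          Ideal.span {(X 1 : MvPolynomial (Fin 3) k), X 2} := by
      induction p using MvPolynomial.induction_on with
      | C a => simp [algebraMap_eq]
      | add p q hp hq =>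
        convert add_mem hp hq using 1
        simp only [map_add]
        ring
      | mul_X p i hp =>
        fin_cases i
        · convert Ideal.mul_mem_right (X 0) _ hp using 1
          simp
          ring
        · simpa using Ideal.mul_mem_left _ p (Ideal.subset_span (by simp))
        · simpa using Ideal.mul_mem_left _ p (Ideal.subset_span (by simp))
    have h1 := h p
    rwa [RingHom.mem_ker.mp hp, map_zero, sub_zero] at h1

lemma prime_algebraMap_X (i : Fin 3) : Prime (algebraMap (MvPolynomial (Fin 3) k) (R13 k) (X i)) := by
  have hinj := IsLocalization.injective (R13 k) (P13 k).primeCompl_le_nonZeroDivisors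
  refine (Ideal.span_singleton_prime ?_).mp ?_
  · exact (map_ne_zero_iff _ hinj).mpr (X_ne_zero i)
  · rw [← Set.image_singleton, ← Ideal.map_span]
    exact isPrime_map_R13 k (span_X_isPrime k i) (span_X_le k i)

lemma primeTriple_R13 : PrimeTriple (algebraMap (MvPolynomial (Fin 3) k) (R13 k) (X 0))
    (algebraMap (MvPolynomial (Fin 3) k) (R13 k) (X 1))
    (algebraMap (MvPolynomial (Fin 3) k) (R13 k) (X 2)) := by
  have hQ : (Ideal.span {(X 1 : MvPolynomial (Fin 3) k), X 2}).IsPrime := by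
    rw [span_X_pair_eq_ker]
    exact RingHom.ker_isPrime _
  have hQP : Ideal.span {(X 1 : MvPolynomial (Fin 3) k), X 2} ≤ P13 k :=
    Ideal.span_mono (Set.subset_insert _ _)
  have hmap : Ideal.span {algebraMap (MvPolynomial (Fin 3) k) (R13 k) (X 1),
      algebraMap (MvPolynomial (Fin 3) k) (R13 k) (X 2)} =
        (Ideal.span {(X 1 : MvPolynomial (Fin 3) k), X 2}).map (algebraMap _ (R13 k)) := by
    rw [Ideal.map_span, Set.image_pair]
  refine ⟨(prime_algebraMap_X k 0).ne_zero, prime_algebraMap_X k 1, prime_algebraMap_X k 2,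
    fun hd => ?_, hmap ▸ isPrime_map_R13 k hQ hQP, fun hm => ?_⟩
  · rw [← Ideal.mem_span_singleton, ← Set.image_singleton, ← Ideal.map_span] at hd
    have h := Ideal.mem_span_singleton.mp
      (algebraMap_mem_map_R13 k (span_X_isPrime k 1) (span_X_le k 1) hd)
    simp [X_dvd_X] at h
  · rw [hmap] at hm
    have h := algebraMap_mem_map_R13 k hQ hQP hm
    rw [span_X_pair_eq_ker] at h
    simp at h

lemma algebraMap_X_mem_jacobson :
    algebraMap (MvPolynomial (Fin 3) k) (R13 k) (X 0) ∈ Ideal.jacobson (⊥ : Ideal (R13 k)) := by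
  rw [IsLocalRing.jacobson_eq_maximalIdeal _ bot_ne_top]
  exact (IsLocalization.AtPrime.to_map_mem_maximal_iff (R13 k) (P13 k) _).mpr (X_mem_P13 k 0)

end

theorem stmt13 (k : Type u) [Field k] :
    ¬ Module.Finite (R13 k) ((R13 k ⧸ I13 k) →ₗ[R13 k]
        ((localCohomology (I13 k) 2).obj (ModuleCat.of (R13 k) (R13 k)))) ∧
    ¬ IsCofinite (R13 k) (I13 k)
        ((localCohomology (I13 k) 1).obj (ModuleCat.of (R13 k) (R13 k))) ∧
    ¬ IsCofinite (R13 k) (I13 k)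
        ((localCohomology (I13 k) 2).obj (ModuleCat.of (R13 k) (R13 k))) := by
  have : IsDomain (R13 k) :=
    IsLocalization.isDomain_of_le_nonZeroDivisors _ (P13 k).primeCompl_le_nonZeroDivisors
  have : IsNoetherianRing (R13 k) :=
    IsLocalization.isNoetherianRing (P13 k).primeCompl _ inferInstance
  have h := primeTriple_R13 k
  have hx := algebraMap_X_mem_jacobson k
  have hI : I13 k = _ := h.inf_eq
  rw [hI]
  exact ⟨h.not_finite_hom hx, fun hc => h.not_finite_ext_two hx (hc.2 2),
    fun hc => h.not_finite_ext_zero hx (hc.2 0)⟩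
end
end

section
/- Let R be a Noetherian local ring, I an ideal of R, and M a finitely generated R-module of dimension at most 3. Then for every i ≥ 0 and every prime p of R outside a set of primes of dimension at most 1 (i.e., outside V(D) for some ideal D with dim R/D ≤ 1), the localization H^i_I(M)_p is I_p-cofinite. In particular, H^i_I(M)_p is I_p-cofinite for all but finitely many primes p of R. -/
open CategoryTheory

noncomputable section

universe u

section ExtComparison
open CategoryTheory.Limits Opposite
variable {R : Type u} [CommRing R] {X Y : ModuleCat.{u} R}

/-- The complex whose homology computes `Ext`, with objects in the opposite category. -/
abbrev opHomComplex (P : ProjectiveResolution X) (Y : ModuleCat.{u} R) :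
    ChainComplex (ModuleCat.{u} R)ᵒᵖ ℕ :=
  (((linearYoneda R (ModuleCat.{u} R)).obj Y).rightOp.mapHomologicalComplex _).obj P.complex

def extHomologyIso (P : ProjectiveResolution X) (Y : ModuleCat.{u} R) (n : ℕ) :
    ((((linearYoneda R (ModuleCat.{u} R)).obj Y).rightOp.leftDerived n).obj X) ≅
      (opHomComplex P Y).homology n :=
  P.isoLeftDerivedObj _ n

abbrev ExtCocycles (P : ProjectiveResolution X) (Y : ModuleCat.{u} R) (n : ℕ) : ModuleCat.{u} R :=
  ((opHomComplex P Y).opcycles n).unop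

def ExtCocycles.toHom (P : ProjectiveResolution X) (Y : ModuleCat.{u} R) (n : ℕ) :
    ExtCocycles P Y n →ₗ[R] (P.complex.X n ⟶ Y) :=
  ((opHomComplex P Y).pOpcycles n).unop.hom

def ExtCocycles.toExt (P : ProjectiveResolution X) (Y : ModuleCat.{u} R) (n : ℕ) :
    ExtCocycles P Y n →ₗ[R] ((Ext R (ModuleCat.{u} R) n).obj (op X)).obj Y :=
  ((extHomologyIso P Y n).hom ≫ (opHomComplex P Y).homologyι n).unop.hom

lemma ExtCocycles.toHom_injective (P : ProjectiveResolution X) (Y : ModuleCat.{u} R) (n : ℕ) :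
    Function.Injective (ExtCocycles.toHom P Y n) := by
  rw [ExtCocycles.toHom]
  exact (ModuleCat.mono_iff_injective _).1 inferInstance

lemma ExtCocycles.d_comp_toHom (P : ProjectiveResolution X) (Y : ModuleCat.{u} R) (n : ℕ) (c) :
    P.complex.d (n + 1) n ≫ ExtCocycles.toHom P Y n c = 0 := by
  have := (opHomComplex P Y).d_pOpcycles (n+1) n
  have := congr($(this).unop.hom c)
  exact this

lemma ExtCocycles.exists_toHom_eq (P : ProjectiveResolution X) (Y : ModuleCat.{u} R) (n : ℕ)
    (f : P.complex.X n ⟶ Y) (hf : P.complex.d (n + 1) n ≫ f = 0) :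
    ∃ c, ExtCocycles.toHom P Y n c = f := by
  let k : (opHomComplex P Y).X n ⟶ op (ModuleCat.of R R) :=
    Quiver.Hom.op (ModuleCat.ofHom (LinearMap.toSpanSingleton R (P.complex.X n ⟶ Y) f))
  have hk : (opHomComplex P Y).d (n + 1) n ≫ k = 0 := by
    apply Quiver.Hom.unop_inj
    ext
    change P.complex.d (n + 1) n ≫ ((1 : R) • f) = 0
    rw [one_smul, hf]
  have h := (opHomComplex P Y).p_descOpcycles k (n + 1) (by simp) hk
  refine ⟨((opHomComplex P Y).descOpcycles k (n + 1) (by simp) hk).unop.hom (1 : R), ?_⟩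
  have h' := congr($(h).unop.hom (1 : R))
  exact h'.trans (one_smul R f)

lemma ExtCocycles.toExt_surjective (P : ProjectiveResolution X) (Y : ModuleCat.{u} R) (n : ℕ) :
    Function.Surjective (ExtCocycles.toExt P Y n) := by
  have (K : ChainComplex (ModuleCat.{u} R)ᵒᵖ ℕ) (Z) (e : Z ≅ K.homology n) :
      Function.Surjective (e.hom ≫ K.homologyι n).unop.hom :=
    (ModuleCat.epi_iff_surjective _).1 inferInstance
  exact this (opHomComplex P Y) _ (extHomologyIso P Y n)

lemma ExtCocycles.toExt_eq_zero_iff (P : ProjectiveResolution X) (Y : ModuleCat.{u} R) (n : ℕ) (c) :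
    ExtCocycles.toExt P Y n c = 0 ↔ ∃ g : P.complex.X ((ComplexShape.down ℕ).next n) ⟶ Y,
      P.complex.d n _ ≫ g = ExtCocycles.toHom P Y n c := by
  let K := opHomComplex P Y
  let S : ShortComplex (ModuleCat.{u} R)ᵒᵖ := ShortComplex.mk _ _ (K.homologyι_comp_fromOpcycles n
    ((ComplexShape.down ℕ).next n))
  have hS : S.Exact := ShortComplex.exact_of_f_is_kernel _ (K.homologyIsKernel n _ rfl)
  have hS' := (ShortComplex.ShortExact.moduleCat_exact_iff_function_exact _).1 hS.unop
  have h1 : ExtCocycles.toExt P Y n c = 0 ↔ (K.homologyι n).unop.hom c = 0 := by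
    let e := (extHomologyIso P Y n).unop
    change e.hom.hom ((K.homologyι n).unop.hom c) = 0 ↔ _
    exact map_eq_zero_iff _ ((ModuleCat.mono_iff_injective e.hom).1 inferInstance)
  rw [h1]
  refine (hS' c).trans ?_
  have h2 : ∀ g : P.complex.X ((ComplexShape.down ℕ).next n) ⟶ Y,
      ExtCocycles.toHom P Y n ((K.fromOpcycles n _).unop.hom g) = P.complex.d n _ ≫ g := by
    intro g
    exact congr($(K.p_fromOpcycles n ((ComplexShape.down ℕ).next n)).unop.hom g)
  constructor
  · rintro ⟨g, hg⟩
    exact ⟨g, by rw [← h2 g]; exact congrArg _ hg⟩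
  · rintro ⟨g, hg⟩
    exact ⟨g, ExtCocycles.toHom_injective P Y n ((h2 g).trans hg)⟩

lemma ProjectiveResolution.extMk_eq_zero_iff_next {X Y : ModuleCat.{u} R}
    (P : ProjectiveResolution X) (n : ℕ)
    (f : P.complex.X n ⟶ Y) (hf : P.complex.d (n + 1) n ≫ f = 0) :
    P.extMk f (n + 1) rfl hf = 0 ↔
      ∃ g : P.complex.X ((ComplexShape.down ℕ).next n) ⟶ Y, P.complex.d n _ ≫ g = f := by
  obtain _ | n := n
  · have h0 : (ComplexShape.down ℕ).next 0 = 0 := by simp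
    have h1 : P.complex.d 0 ((ComplexShape.down ℕ).next 0) = 0 := P.complex.shape _ _ (by simp)
    simp only [h1, zero_comp, exists_const]
    rw [← P.extEquivCohomologyClass.apply_eq_iff_eq, P.extEquivCohomologyClass_extMk,
      P.extEquivCohomologyClass_zero, CochainComplex.HomComplex.CohomologyClass.mk_eq_zero_iff,
      CochainComplex.HomComplex.Cocycle.toSingleMk_mem_coboundaries_iff _ _ _ _ _ 1 (by simp)]
    have hz : IsZero (P.cochainComplex.X 1) := P.cochainComplex.isZero_of_isStrictlyLE 0 1
    constructor
    · rintro ⟨g, hg⟩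
      rw [hz.eq_of_src g 0, comp_zero] at hg
      rw [← cancel_epi (P.cochainComplexXIso (-(0 : ℕ)) 0 rfl).hom, ← hg, comp_zero]
    · rintro rfl
      exact ⟨0, by simp⟩
  · rw [P.extMk_eq_zero_iff f _ rfl hf n rfl]
    rw [ChainComplex.next_nat_succ]

def ExtCocycles.toAbelianExt (P : ProjectiveResolution X) (Y : ModuleCat.{u} R) (n : ℕ) :
    ExtCocycles P Y n →ₗ[R] Abelian.Ext X Y n where
  toFun c := P.extMk (ExtCocycles.toHom P Y n c) (n + 1) rfl (ExtCocycles.d_comp_toHom P Y n c)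
  map_add' c c' := by simp [P.add_extMk]
  map_smul' r c := by
    rw [Abelian.Ext.smul_eq_comp_mk₀, P.extMk_comp_mk₀]
    simp

lemma ExtCocycles.toAbelianExt_surjective (P : ProjectiveResolution X) (Y : ModuleCat.{u} R)
    (n : ℕ) : Function.Surjective (ExtCocycles.toAbelianExt P Y n) := by
  intro a
  obtain ⟨f, hf, rfl⟩ := P.extMk_surjective a (n + 1) rfl
  obtain ⟨c, rfl⟩ := ExtCocycles.exists_toHom_eq P Y n f hf
  exact ⟨c, rfl⟩

lemma ExtCocycles.ker_toExt (P : ProjectiveResolution X) (Y : ModuleCat.{u} R) (n : ℕ) :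
    LinearMap.ker (ExtCocycles.toExt P Y n) = LinearMap.ker (ExtCocycles.toAbelianExt P Y n) := by
  ext c
  rw [LinearMap.mem_ker, LinearMap.mem_ker, ExtCocycles.toExt_eq_zero_iff]
  exact (ProjectiveResolution.extMk_eq_zero_iff_next P n _
    (ExtCocycles.d_comp_toHom P Y n c)).symm

/-- The comparison between `Ext` defined by projective resolutions and `Ext` defined in the
derived category. -/
def extComparison (X Y : ModuleCat.{u} R) (n : ℕ) :
    (((Ext R (ModuleCat.{u} R) n).obj (op X)).obj Y) ≃ₗ[R] Abelian.Ext X Y n :=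
  ((ExtCocycles.toExt (projectiveResolution X) Y n).quotKerEquivOfSurjective
      (ExtCocycles.toExt_surjective _ _ _)).symm ≪≫ₗ
    Submodule.quotEquivOfEq _ _ (ExtCocycles.ker_toExt _ _ _) ≪≫ₗ
    ((ExtCocycles.toAbelianExt (projectiveResolution X) Y n).quotKerEquivOfSurjective
      (ExtCocycles.toAbelianExt_surjective _ _ _))

lemma extComparison_toExt (X Y : ModuleCat.{u} R) (n : ℕ) (c) :
    extComparison X Y n (ExtCocycles.toExt (projectiveResolution X) Y n c) =
      ExtCocycles.toAbelianExt (projectiveResolution X) Y n c := by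
  have h : ((ExtCocycles.toExt (projectiveResolution X) Y n).quotKerEquivOfSurjective
      (ExtCocycles.toExt_surjective _ _ _)).symm (ExtCocycles.toExt (projectiveResolution X) Y n c)
      = Submodule.Quotient.mk c := by
    rw [LinearEquiv.symm_apply_eq]
    rfl
  simp only [extComparison, LinearEquiv.trans_apply, h]
  rfl

lemma extComparison_map (X : ModuleCat.{u} R) {Y Y' : ModuleCat.{u} R} (g : Y ⟶ Y') (n : ℕ) (a) :
    extComparison X Y' n ((((Ext R (ModuleCat.{u} R) n).obj (op X)).map g).hom a) =
      (extComparison X Y n a).comp (Abelian.Ext.mk₀ g) (add_zero n) := by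
  let P := projectiveResolution X
  obtain ⟨c, rfl⟩ := ExtCocycles.toExt_surjective P Y n a
  let φ : opHomComplex P Y' ⟶ opHomComplex P Y := 
    (NatTrans.mapHomologicalComplex (NatTrans.rightOp ((linearYoneda R (ModuleCat.{u} R)).map g)) _).app
      P.complex
  let c' : ExtCocycles P Y' n := (HomologicalComplex.opcyclesMap φ n).unop.hom c
  have h1 : ExtCocycles.toHom P Y' n c' = ExtCocycles.toHom P Y n c ≫ g :=
    congr($(HomologicalComplex.p_opcyclesMap φ n).unop.hom c)
  have h2 : (((Ext R (ModuleCat.{u} R) n).obj (op X)).map g).hom (ExtCocycles.toExt P Y n c) =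
      ExtCocycles.toExt P Y' n c' := by
    have h3 : (NatTrans.leftDerived (NatTrans.rightOp
        ((linearYoneda R (ModuleCat.{u} R)).map g)) n).app X ≫ (extHomologyIso P Y n).hom =
        (extHomologyIso P Y' n).hom ≫ HomologicalComplex.homologyMap φ n := by
      rw [ProjectiveResolution.leftDerived_app_eq _ P n]
      exact (Category.assoc _ _ _).trans ((congrArg _
        ((Category.assoc _ _ _).trans ((congrArg _ (Iso.inv_hom_id _)).trans
          (Category.comp_id _)))))
    have h4 : (NatTrans.leftDerived (NatTrans.rightOp
        ((linearYoneda R (ModuleCat.{u} R)).map g)) n).app X ≫ (extHomologyIso P Y n).hom ≫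
          (opHomComplex P Y).homologyι n =
        ((extHomologyIso P Y' n).hom ≫ (opHomComplex P Y').homologyι n) ≫
          HomologicalComplex.opcyclesMap φ n := by
      rw [reassoc_of% h3, HomologicalComplex.homologyι_naturality, Category.assoc]
    exact congr($(h4).unop.hom c)
  rw [h2, extComparison_toExt, extComparison_toExt]
  refine Eq.trans ?_ (P.extMk_comp_mk₀ _ (n + 1) rfl
    (ExtCocycles.d_comp_toHom P Y n c) g).symm
  simp only [← h1]
  rfl

lemma extComparison_map_op {X X' : ModuleCat.{u} R} (f : X' ⟶ X) (Y : ModuleCat.{u} R) (n : ℕ) (a) :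
    extComparison X' Y n ((((Ext R (ModuleCat.{u} R) n).map f.op).app Y).hom a) =
      (Abelian.Ext.mk₀ f).comp (extComparison X Y n a) (zero_add n) := by
  let P := projectiveResolution X
  let P' := projectiveResolution X'
  obtain ⟨c, rfl⟩ := ExtCocycles.toExt_surjective P Y n a
  let ψ : ProjectiveResolution.Hom P' P f := 
    { hom := ProjectiveResolution.lift f P' P
      hom_f_zero_comp_π_f_zero := by
        have := HomologicalComplex.congr_hom (ProjectiveResolution.lift_commutes f P' P) 0
        exact this.trans (by simp) }
  let F := ((linearYoneda R (ModuleCat.{u} R)).obj Y).rightOp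
  let φ : opHomComplex P' Y ⟶ opHomComplex P Y := 
    (F.mapHomologicalComplex _).map ψ.hom
  let c' : ExtCocycles P' Y n := (HomologicalComplex.opcyclesMap φ n).unop.hom c
  have h1 : ExtCocycles.toHom P' Y n c' = ψ.hom.f n ≫ ExtCocycles.toHom P Y n c :=
    congr($(HomologicalComplex.p_opcyclesMap φ n).unop.hom c)
  have h2 : (((Ext R (ModuleCat.{u} R) n).map f.op).app Y).hom (ExtCocycles.toExt P Y n c) =
      ExtCocycles.toExt P' Y n c' := by
    have h3 : (F.leftDerived n).map f ≫ (extHomologyIso P Y n).hom =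
        (extHomologyIso P' Y n).hom ≫ HomologicalComplex.homologyMap φ n :=
      ProjectiveResolution.isoLeftDerivedObj_hom_naturality f P' P ψ.hom
        ψ.hom_f_zero_comp_π_f_zero F n
    have h4 : (F.leftDerived n).map f ≫ (extHomologyIso P Y n).hom ≫
          (opHomComplex P Y).homologyι n =
        ((extHomologyIso P' Y n).hom ≫ (opHomComplex P' Y).homologyι n) ≫
          HomologicalComplex.opcyclesMap φ n := by
      rw [reassoc_of% h3, HomologicalComplex.homologyι_naturality, Category.assoc]
    exact congr($(h4).unop.hom c)
  rw [h2, extComparison_toExt, extComparison_toExt]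
  refine Eq.trans ?_ (ProjectiveResolution.mk₀_comp_extMk _ (n + 1) rfl
    (ExtCocycles.d_comp_toHom P Y n c) ψ).symm
  simp only [← h1]
  rfl

end ExtComparison

section LocalCohomologyElements
open CategoryTheory.Limits Opposite
variable {R : Type u} [CommRing R]

abbrev lc (I : Ideal R) (i : ℕ) (M : ModuleCat.{u} R) : ModuleCat.{u} R :=
  (localCohomology I i).obj M

abbrev quotPow (I : Ideal R) (n : ℕ) : ModuleCat.{u} R := ModuleCat.of R (R ⧸ I ^ n)

def quotPowMap (I : Ideal R) {n m : ℕ} (h : n ≤ m) : quotPow I m ⟶ quotPow I n :=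
  ModuleCat.ofHom (Submodule.mapQ (I ^ m) (I ^ n) LinearMap.id (Ideal.pow_le_pow_right h))

def lcDiagram (I : Ideal R) (i : ℕ) (M : ModuleCat.{u} R) : (ℕᵒᵖ)ᵒᵖ ⥤ ModuleCat.{u} R :=
  localCohomology.diagram (localCohomology.idealPowersDiagram I) i ⋙
    (evaluation _ _).obj M

def lcCocone (I : Ideal R) (i : ℕ) (M : ModuleCat.{u} R) : Cocone (lcDiagram I i M) :=
  ((evaluation _ _).obj M).mapCocone
    (colimit.cocone (localCohomology.diagram (localCohomology.idealPowersDiagram I) i))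

def lcIsColimit (I : Ideal R) (i : ℕ) (M : ModuleCat.{u} R) : IsColimit (lcCocone I i M) :=
  isColimitOfPreserves _ (colimit.isColimit _)

instance lcDiagram_preservesColimit (I : Ideal R) (i : ℕ) (M : ModuleCat.{u} R) :
    PreservesColimit (lcDiagram I i M) (forget (ModuleCat.{u} R)) :=
  have : PreservesFilteredColimitsOfSize.{0, 0} (forget (ModuleCat.{u} R)) :=
    preservesFilteredColimitsOfSize_shrink _
  inferInstance

def lcStage (I : Ideal R) (i : ℕ) (M : ModuleCat.{u} R) (n : ℕ) :
    ((Ext R (ModuleCat.{u} R) i).obj (op (quotPow I n))).obj M →ₗ[R] lc I i M :=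
  ((lcCocone I i M).ι.app (op (op n))).hom

lemma lcStage_surjective (I : Ideal R) (i : ℕ) (M : ModuleCat.{u} R) (z : lc I i M) :
    ∃ n a, lcStage I i M n a = z := by
  obtain ⟨j, y, hy⟩ := Concrete.isColimit_exists_rep _ (lcIsColimit I i M) z
  exact ⟨j.unop.unop, y, hy⟩

lemma lcStage_map (I : Ideal R) (i : ℕ) (M : ModuleCat.{u} R) {n m : ℕ} (h : n ≤ m)
    (a : ((Ext R (ModuleCat.{u} R) i).obj (op (quotPow I n))).obj M) :
    lcStage I i M m ((((Ext R (ModuleCat.{u} R) i).map (quotPowMap I h).op).app M).hom a) =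
      lcStage I i M n a :=
  congr($((lcCocone I i M).w (homOfLE h).op.op).hom a)

lemma exists_of_lcStage_eq_zero (I : Ideal R) (i : ℕ) (M : ModuleCat.{u} R) {n : ℕ}
    (a : ((Ext R (ModuleCat.{u} R) i).obj (op (quotPow I n))).obj M)
    (ha : lcStage I i M n a = 0) :
    ∃ (m : ℕ) (h : n ≤ m),
      (((Ext R (ModuleCat.{u} R) i).map (quotPowMap I h).op).app M).hom a = 0 := by
  obtain ⟨k, f, g, hfg⟩ := Concrete.isColimit_exists_of_rep_eq _ (lcIsColimit I i M)
    (i := op (op n)) (j := op (op n)) a 0 (ha.trans (map_zero (ModuleCat.Hom.hom _)).symm)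
  exact ⟨_, leOfHom f.unop.unop, hfg.trans (map_zero (ModuleCat.Hom.hom _))⟩

lemma localCohomology_map_lcStage (I : Ideal R) (i : ℕ) {M N : ModuleCat.{u} R} (f : M ⟶ N)
    {n : ℕ} (a : ((Ext R (ModuleCat.{u} R) i).obj (op (quotPow I n))).obj M) :
    ((localCohomology I i).map f).hom (lcStage I i M n a) =
      lcStage I i N n ((((Ext R (ModuleCat.{u} R) i).obj (op (quotPow I n))).map f).hom a) :=
  congr($((colimit.ι (localCohomology.diagram (localCohomology.idealPowersDiagram I) i)
    (op (op n))).naturality f).hom a).symm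

def lcι (I : Ideal R) (i : ℕ) (M : ModuleCat.{u} R) (n : ℕ) :
    Abelian.Ext (quotPow I n) M i →ₗ[R] lc I i M :=
  lcStage I i M n ∘ₗ (extComparison (quotPow I n) M i).symm.toLinearMap

lemma lcι_extComparison (I : Ideal R) (i : ℕ) (M : ModuleCat.{u} R) (n : ℕ) (a) :
    lcι I i M n (extComparison (quotPow I n) M i a) = lcStage I i M n a := by
  simp [lcι]

lemma lcι_surjective (I : Ideal R) (i : ℕ) (M : ModuleCat.{u} R) (z : lc I i M) :
    ∃ n a, lcι I i M n a = z := by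
  obtain ⟨n, a, h⟩ := lcStage_surjective I i M z
  exact ⟨n, _, (lcι_extComparison I i M n a).trans h⟩

lemma lcι_map (I : Ideal R) (i : ℕ) (M : ModuleCat.{u} R) {n m : ℕ} (h : n ≤ m)
    (a : Abelian.Ext (quotPow I n) M i) :
    lcι I i M m ((Abelian.Ext.mk₀ (quotPowMap I h)).comp a (zero_add i)) = lcι I i M n a := by
  obtain ⟨a, rfl⟩ := (extComparison (quotPow I n) M i).surjective a
  rw [← extComparison_map_op, lcι_extComparison, lcι_extComparison, lcStage_map]

lemma exists_of_lcι_eq_zero (I : Ideal R) (i : ℕ) (M : ModuleCat.{u} R) {n : ℕ}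
    (a : Abelian.Ext (quotPow I n) M i) (ha : lcι I i M n a = 0) :
    ∃ (m : ℕ) (h : n ≤ m), (Abelian.Ext.mk₀ (quotPowMap I h)).comp a (zero_add i) = 0 := by
  obtain ⟨a, rfl⟩ := (extComparison (quotPow I n) M i).surjective a
  rw [lcι_extComparison] at ha
  obtain ⟨m, h, h'⟩ := exists_of_lcStage_eq_zero I i M a ha
  exact ⟨m, h, by rw [← extComparison_map_op, h', map_zero]⟩

lemma localCohomology_map_lcι (I : Ideal R) (i : ℕ) {M N : ModuleCat.{u} R} (f : M ⟶ N) {n : ℕ}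
    (a : Abelian.Ext (quotPow I n) M i) :
    ((localCohomology I i).map f).hom (lcι I i M n a) =
      lcι I i N n (a.comp (Abelian.Ext.mk₀ f) (add_zero i)) := by
  obtain ⟨a, rfl⟩ := (extComparison (quotPow I n) M i).surjective a
  rw [← extComparison_map, lcι_extComparison, lcι_extComparison, localCohomology_map_lcStage]

lemma exists_lcDesc (I : Ideal R) (i : ℕ) (M : ModuleCat.{u} R) (N : ModuleCat.{u} R)
    (φ : ∀ n, Abelian.Ext (quotPow I n) M i →ₗ[R] N)
    (hφ : ∀ n m (h : n ≤ m) a,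
      φ m ((Abelian.Ext.mk₀ (quotPowMap I h)).comp a (zero_add i)) = φ n a) :
    ∃ ψ : lc I i M →ₗ[R] N, ∀ n a, ψ (lcι I i M n a) = φ n a := by
  let s : Cocone (lcDiagram I i M) :=
    { pt := N
      ι := { app := fun j => ModuleCat.ofHom
               (φ j.unop.unop ∘ₗ (extComparison (quotPow I j.unop.unop) M i).toLinearMap)
             naturality := by
              intro j k f
              ext a
              have h := leOfHom f.unop.unop
              exact (congrArg (φ _) (extComparison_map_op (quotPowMap I h) M i a)).trans
                (hφ _ _ h (extComparison (quotPow I j.unop.unop) M i a)) } }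
  refine ⟨((lcIsColimit I i M).desc s).hom, fun n a => ?_⟩
  obtain ⟨a, rfl⟩ := (extComparison (quotPow I n) M i).surjective a
  rw [lcι_extComparison]
  exact congr($((lcIsColimit I i M).fac s (op (op n))).hom a)

end LocalCohomologyElements

section LocalCohomologySequence
open CategoryTheory.Limits Opposite
variable {R : Type u} [CommRing R] (I : Ideal R) (i : ℕ)
  {A B C : Type u} [AddCommGroup A] [AddCommGroup B] [AddCommGroup C]
  [Module R A] [Module R B] [Module R C]

abbrev LC (A : Type u) [AddCommGroup A] [Module R A] : Type u :=
  ↥((localCohomology I i).obj (ModuleCat.of R A))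

def lcMap (f : A →ₗ[R] B) : LC I i A →ₗ[R] LC I i B :=
  ((localCohomology I i).map (ModuleCat.ofHom f)).hom

lemma lcMap_lcι (f : A →ₗ[R] B) {n : ℕ} (a : Abelian.Ext (quotPow I n) (ModuleCat.of R A) i) :
    lcMap I i f (lcι I i _ n a) =
      lcι I i _ n (a.comp (Abelian.Ext.mk₀ (ModuleCat.ofHom f)) (add_zero i)) :=
  localCohomology_map_lcι I i _ a

lemma lcMap_comp (f : A →ₗ[R] B) (g : B →ₗ[R] C) :
    lcMap I i (g ∘ₗ f) = lcMap I i g ∘ₗ lcMap I i f := by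
  simp [lcMap]

lemma lcMap_smul_id (r : R) : lcMap I i (r • (LinearMap.id : A →ₗ[R] A)) = r • LinearMap.id := by
  ext z
  obtain ⟨n, a, rfl⟩ := lcι_surjective I i _ z
  rw [lcMap_lcι]
  have : ModuleCat.ofHom (r • (LinearMap.id : A →ₗ[R] A)) = r • 𝟙 (ModuleCat.of R A) := rfl
  rw [this, ← Abelian.Ext.smul_eq_comp_mk₀]
  simp

lemma lcMap_zero : lcMap I i (0 : A →ₗ[R] B) = 0 := by
  have h := lcMap_comp I i (0 : A →ₗ[R] B) ((0 : R) • LinearMap.id)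
  rwa [lcMap_smul_id, zero_smul, LinearMap.comp_zero, zero_smul, LinearMap.zero_comp] at h

lemma lcMap_smul_id_apply (r : R) (z : LC I i A) :
    lcMap I i (r • (LinearMap.id : A →ₗ[R] A)) z = r • z := by
  simp [lcMap_smul_id]

lemma shortExact_ofHom (f : A →ₗ[R] B) (g : B →ₗ[R] C) (hf : Function.Injective f)
    (hfg : Function.Exact f g) (hg : Function.Surjective g) :
    (ShortComplex.mk (ModuleCat.ofHom f) (ModuleCat.ofHom g)
      (by ext x; exact hfg.apply_apply_eq_zero x)).ShortExact where
  exact := (ShortComplex.ShortExact.moduleCat_exact_iff_function_exact _).2 hfg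
  mono_f := (ModuleCat.mono_iff_injective _).2 hf
  epi_g := (ModuleCat.epi_iff_surjective _).2 hg

lemma lcMap_exact {f : A →ₗ[R] B} {g : B →ₗ[R] C} (hf : Function.Injective f)
    (hfg : Function.Exact f g) (hg : Function.Surjective g) :
    Function.Exact (lcMap I i f) (lcMap I i g) := by
  have hS := shortExact_ofHom f g hf hfg hg
  intro z
  constructor
  · intro hz
    obtain ⟨n, a, rfl⟩ := lcι_surjective I i _ z
    rw [lcMap_lcι] at hz
    obtain ⟨m, h, h'⟩ := exists_of_lcι_eq_zero _ _ _ _ hz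
    rw [← Abelian.Ext.comp_assoc_of_third_deg_zero] at h'
    obtain ⟨b, hb⟩ := Abelian.Ext.covariant_sequence_exact₂ _ hS _ h'
    exact ⟨lcι I i _ m b, by rw [lcMap_lcι, ← lcι_map I i _ h a, ← hb]⟩
  · rintro ⟨y, rfl⟩
    rw [← LinearMap.comp_apply, ← lcMap_comp, hfg.linearMap_comp_eq_zero, lcMap_zero,
      LinearMap.zero_apply]

lemma exists_lcδ {f : A →ₗ[R] B} {g : B →ₗ[R] C} (hf : Function.Injective f)
    (hfg : Function.Exact f g) (hg : Function.Surjective g) :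
    ∃ δ : LC I i C →ₗ[R] LC I (i + 1) A,
      Function.Exact (lcMap I i g) δ ∧ Function.Exact δ (lcMap I (i + 1) f) := by
  have hS := shortExact_ofHom f g hf hfg hg
  obtain ⟨δ, hδ⟩ := exists_lcDesc I i (ModuleCat.of R C) (lc I (i + 1) (ModuleCat.of R A))
    (fun n => lcι I (i + 1) (ModuleCat.of R A) n ∘ₗ
      (Abelian.Ext.bilinearCompOfLinear R (quotPow I n) (ModuleCat.of R C) (ModuleCat.of R A)
        i 1 (i + 1) rfl).flip hS.extClass) (by
    intro n m h a
    refine Eq.trans (congrArg (lcι I (i + 1) (ModuleCat.of R A) m) ?_)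
      (lcι_map I (i + 1) (ModuleCat.of R A) h (a.comp hS.extClass rfl))
    exact Abelian.Ext.comp_assoc _ _ _ (zero_add i) rfl (by omega))
  replace hδ : ∀ n a, δ (lcι I i _ n a) = lcι I (i + 1) _ n (a.comp hS.extClass rfl) := hδ
  refine ⟨δ, fun z => ⟨fun hz => ?_, ?_⟩, fun z => ⟨fun hz => ?_, ?_⟩⟩
  · obtain ⟨n, a, rfl⟩ := lcι_surjective I i _ z
    rw [hδ] at hz
    obtain ⟨m, h, h'⟩ := exists_of_lcι_eq_zero _ _ _ _ hz
    rw [← Abelian.Ext.comp_assoc (h₁₂ := zero_add i) (h₂₃ := rfl) (h := by omega)] at h'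
    obtain ⟨b, hb⟩ := Abelian.Ext.covariant_sequence_exact₃ _ hS _ _ h'
    exact ⟨lcι I i _ m b, by rw [lcMap_lcι, ← lcι_map I i _ h a, ← hb]⟩
  · rintro ⟨y, rfl⟩
    obtain ⟨n, a, rfl⟩ := lcι_surjective I i _ y
    rw [lcMap_lcι, hδ, Abelian.Ext.comp_assoc_of_second_deg_zero, hS.comp_extClass]
    simp
  · obtain ⟨n, a, rfl⟩ := lcι_surjective I (i + 1) _ z
    rw [lcMap_lcι] at hz
    obtain ⟨m, h, h'⟩ := exists_of_lcι_eq_zero _ _ _ _ hz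
    rw [← Abelian.Ext.comp_assoc_of_third_deg_zero] at h'
    obtain ⟨b, hb⟩ := Abelian.Ext.covariant_sequence_exact₁ _ hS _ h' rfl
    exact ⟨lcι I i _ m b, by rw [hδ, ← lcι_map I _ _ h a, ← hb]⟩
  · rintro ⟨y, rfl⟩
    obtain ⟨n, a, rfl⟩ := lcι_surjective I i _ y
    rw [hδ, lcMap_lcι, Abelian.Ext.comp_assoc_of_third_deg_zero, hS.extClass_comp]
    simp

end LocalCohomologySequence

section LocalCohomologyTorsion
variable {R : Type u} [CommRing R] (I : Ideal R)
  {A B C : Type u} [AddCommGroup A] [AddCommGroup B] [AddCommGroup C]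
  [Module R A] [Module R B] [Module R C]

lemma exists_pow_smul_lc_eq_zero (i : ℕ) (z : LC I i A) : ∃ n, ∀ r ∈ I ^ n, r • z = 0 := by
  obtain ⟨n, a, rfl⟩ := lcι_surjective I i _ z
  refine ⟨n, fun r hr => ?_⟩
  have h0 : r • 𝟙 (quotPow I n) = 0 := by
    ext
    change r • (Submodule.Quotient.mk 1 : R ⧸ I ^ n) = 0
    rw [← Submodule.Quotient.mk_smul, Submodule.Quotient.mk_eq_zero]
    simpa using hr
  have : r • a = 0 := by
    rw [← Abelian.Ext.mk₀_id_comp a, ← Abelian.Ext.smul_comp, ← Abelian.Ext.mk₀_smul, h0,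
      Abelian.Ext.mk₀_zero, Abelian.Ext.zero_comp]
  rw [← map_smul, this, map_zero]

lemma smul_lc_eq_zero (i : ℕ) {r : R} (hr : ∀ a : A, r • a = 0) (z : LC I i A) : r • z = 0 := by
  rw [← lcMap_smul_id_apply, show r • (LinearMap.id : A →ₗ[R] A) = 0 from LinearMap.ext hr,
    lcMap_zero, LinearMap.zero_apply]

lemma subsingleton_lc_of_injective (i : ℕ) [Injective (ModuleCat.of R A)] :
    Subsingleton (LC I (i + 1) A) :=
  subsingleton_of_forall_eq 0 fun z => by
    obtain ⟨n, a, rfl⟩ := lcι_surjective I (i + 1) _ z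
    rw [Abelian.Ext.eq_zero_of_injective a, map_zero]

lemma exists_lcZeroTo (A : Type u) [AddCommGroup A] [Module R A] :
    ∃ ε : LC I 0 A →ₗ[R] A, ∀ n (f : quotPow I n ⟶ ModuleCat.of R A),
      ε (lcι I 0 _ n (Abelian.Ext.mk₀ f)) = f.hom (Submodule.Quotient.mk 1) := by
  let φ (n : ℕ) : Abelian.Ext (quotPow I n) (ModuleCat.of R A) 0 →ₗ[R] A :=
    LinearMap.applyₗ (Submodule.Quotient.mk 1 : R ⧸ I ^ n) ∘ₗ
      (ModuleCat.homLinearEquiv (S := R)).toLinearMap ∘ₗ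
      (Abelian.Ext.linearEquiv₀ (R := R)).toLinearMap
  have hφ (n) (f : quotPow I n ⟶ ModuleCat.of R A) :
      φ n (Abelian.Ext.mk₀ f) = f.hom (Submodule.Quotient.mk 1) :=
    congr(ModuleCat.Hom.hom $(Abelian.Ext.addEquiv₀.right_inv f) (Submodule.Quotient.mk 1))
  obtain ⟨ε, h⟩ := exists_lcDesc I 0 (ModuleCat.of R A) (ModuleCat.of R A) φ (by
    intro n m h a
    obtain ⟨f, rfl⟩ := (Abelian.Ext.mk₀_bijective _ _).2 a
    rw [Abelian.Ext.mk₀_comp_mk₀, hφ, hφ]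
    rfl)
  exact ⟨ε, fun n f => (h n _).trans (hφ n f)⟩

def lcZeroTo (A : Type u) [AddCommGroup A] [Module R A] : LC I 0 A →ₗ[R] A :=
  (exists_lcZeroTo I A).choose

lemma lcZeroTo_lcι (n : ℕ) (f : quotPow I n ⟶ ModuleCat.of R A) :
    lcZeroTo I A (lcι I 0 _ n (Abelian.Ext.mk₀ f)) = f.hom (Submodule.Quotient.mk 1) :=
  (exists_lcZeroTo I A).choose_spec n f

lemma exists_lcι_zero_eq (z : LC I 0 A) :
    ∃ n, ∃ f : quotPow I n ⟶ ModuleCat.of R A, lcι I 0 _ n (Abelian.Ext.mk₀ f) = z := by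
  obtain ⟨n, a, rfl⟩ := lcι_surjective I 0 _ z
  obtain ⟨f, rfl⟩ := (Abelian.Ext.mk₀_bijective _ _).2 a
  exact ⟨n, f, rfl⟩

lemma lcZeroTo_injective : Function.Injective (lcZeroTo I A) := by
  rw [injective_iff_map_eq_zero]
  intro z hz
  obtain ⟨n, f, rfl⟩ := exists_lcι_zero_eq I z
  rw [lcZeroTo_lcι] at hz
  have : f = 0 := by
    ext
    exact hz
  rw [this, Abelian.Ext.mk₀_zero, map_zero]

lemma lcZeroTo_lcMap (f : A →ₗ[R] B) (z : LC I 0 A) :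
    lcZeroTo I B (lcMap I 0 f z) = f (lcZeroTo I A z) := by
  obtain ⟨n, g, rfl⟩ := exists_lcι_zero_eq I z
  rw [lcMap_lcι, Abelian.Ext.mk₀_comp_mk₀, lcZeroTo_lcι, lcZeroTo_lcι]
  rfl

lemma exists_lcZeroTo_eq {a : A} {n : ℕ} (ha : ∀ r ∈ I ^ n, r • a = 0) :
    ∃ z, lcZeroTo I A z = a := by
  refine ⟨lcι I 0 _ n (Abelian.Ext.mk₀ (ModuleCat.ofHom
    ((I ^ n).liftQ (LinearMap.toSpanSingleton R A a) ha))), ?_⟩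
  rw [lcZeroTo_lcι]
  exact (Submodule.liftQ_apply _ _ _).trans (one_smul R a)

lemma finite_lc_zero [IsNoetherianRing R] [Module.Finite R A] : Module.Finite R (LC I 0 A) :=
  Module.Finite.of_injective _ (lcZeroTo_injective I)

end LocalCohomologyTorsion

section PowTorsion
variable {R : Type u} [CommRing R] (I : Ideal R)
  {A B C : Type u} [AddCommGroup A] [AddCommGroup B] [AddCommGroup C]
  [Module R A] [Module R B] [Module R C]

/-- The submodule of elements killed by a power of `I`. -/
def powTorsion (A : Type*) [AddCommGroup A] [Module R A] : Submodule R A where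
  carrier := {a | ∃ n, ∀ r ∈ I ^ n, r • a = 0}
  add_mem' := by
    rintro a b ⟨n, hn⟩ ⟨m, hm⟩
    refine ⟨n + m, fun r hr => ?_⟩
    rw [smul_add, hn r (Ideal.pow_le_pow_right (by omega) hr),
      hm r (Ideal.pow_le_pow_right (by omega) hr), add_zero]
  zero_mem' := ⟨0, by simp⟩
  smul_mem' := by
    rintro c a ⟨n, hn⟩
    exact ⟨n, fun r hr => by rw [smul_comm, hn r hr, smul_zero]⟩

variable {I} in
lemma mem_powTorsion {a : A} : a ∈ powTorsion I A ↔ ∃ n, ∀ r ∈ I ^ n, r • a = 0 := Iff.rfl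

lemma powTorsion_powTorsion : powTorsion I (powTorsion I A) = ⊤ :=
  eq_top_iff.2 fun z _ => z.2.imp fun _ h r hr => Subtype.ext (h r hr)

lemma powTorsion_eq_top_of_surjective {f : A →ₗ[R] B} (hf : Function.Surjective f)
    (hA : powTorsion I A = ⊤) : powTorsion I B = ⊤ := by
  refine eq_top_iff.2 fun z _ => ?_
  obtain ⟨a, rfl⟩ := hf z
  obtain ⟨n, hn⟩ := mem_powTorsion.1 (hA.ge (Submodule.mem_top (x := a)))
  exact ⟨n, fun r hr => by rw [← map_smul, hn r hr, map_zero]⟩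

lemma exists_pow_smul_eq_zero_of_fg [IsNoetherianRing R] {N : Submodule R A} (hN : N.FG)
    (h : N ≤ powTorsion I A) :
    ∃ n, ∀ r ∈ I ^ n, ∀ a ∈ N, r • a = 0 := by
  obtain ⟨S, rfl⟩ := hN
  rw [Submodule.span_le] at h
  choose! n hn using h
  refine ⟨S.sup n, fun r hr a ha => ?_⟩
  induction ha using Submodule.span_induction with
  | mem x hx => exact hn hx r (Ideal.pow_le_pow_right (Finset.le_sup (f := n) hx) hr)
  | zero => simp
  | add x y _ _ hx hy => rw [smul_add, hx, hy, add_zero]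
  | smul c x _ hx => rw [smul_comm, hx, smul_zero]

lemma baer_powTorsion [IsNoetherianRing R] (E : Type u) [AddCommGroup E] [Module R E]
    [hE : Module.Injective R E] : Module.Baer R (powTorsion I E) := by
  intro 𝔞 f
  obtain ⟨n, hn⟩ := exists_pow_smul_eq_zero_of_fg I (N := LinearMap.range f)
    ((LinearMap.range_eq_map f) ▸ Submodule.FG.map _ (Module.Finite.fg_top))
    (by rw [powTorsion_powTorsion]; exact le_top)
  obtain ⟨k, hk⟩ := Ideal.exists_pow_inf_eq_pow_smul I (M := R) 𝔞
  let π : 𝔞 →ₗ[R] R ⧸ I ^ (n + k) := (Submodule.mkQ (I ^ (n + k))) ∘ₗ 𝔞.subtype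
  have hπ : LinearMap.ker π ≤ LinearMap.ker ((powTorsion I E).subtype ∘ₗ f) := by
    intro x hx
    have hx1 : (x : R) ∈ I ^ (n + k) • (⊤ : Submodule R R) ⊓ 𝔞 := by
      refine ⟨?_, x.2⟩
      have : (x : R) ∈ I ^ (n + k) := by
        simpa [π, Ideal.Quotient.eq_zero_iff_mem] using hx
      simpa using this
    rw [hk _ (by omega), Nat.add_sub_cancel] at hx1
    have hx2 : (x : R) ∈ I ^ n • 𝔞 :=
      Submodule.smul_mono le_rfl inf_le_right hx1
    have hx3 : x ∈ I ^ n • (⊤ : Submodule R 𝔞) := by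
      have h : (I ^ n • (⊤ : Submodule R 𝔞)).map 𝔞.subtype = I ^ n • 𝔞 := by
        rw [Submodule.map_smul'', Submodule.map_top, Submodule.range_subtype]
      obtain ⟨y, hy, hxy⟩ := h.ge hx2
      rwa [← Subtype.ext hxy]
    rw [LinearMap.mem_ker]
    refine Submodule.smul_induction_on hx3 ?_ ?_
    · intro r hr y _
      have := congrArg Subtype.val (hn r hr (f y) ⟨y, rfl⟩)
      simpa using this
    · intro y z hy hz
      rw [map_add, hy, hz, add_zero]
  obtain ⟨h, hh⟩ := hE.out (LinearMap.ker π |>.liftQ π le_rfl)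
    (LinearMap.ker_eq_bot.1 (Submodule.ker_liftQ_eq_bot _ _ _ le_rfl))
    ((LinearMap.ker π).liftQ _ hπ)
  let e : powTorsion I E := ⟨h (Submodule.Quotient.mk 1), n + k, fun r hr => by
    rw [← map_smul, ← Submodule.Quotient.mk_smul, (Submodule.Quotient.mk_eq_zero _).2 (by simpa),
      map_zero]⟩
  refine ⟨LinearMap.toSpanSingleton R _ e, fun x hx => Subtype.ext ?_⟩
  have := hh (Submodule.Quotient.mk ⟨x, hx⟩)
  rw [Submodule.liftQ_apply, Submodule.liftQ_apply] at this
  refine Eq.trans ?_ this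
  change x • h _ = h (Submodule.Quotient.mk x)
  rw [← map_smul, ← Submodule.Quotient.mk_smul, smul_eq_mul, mul_one]

lemma lcMap_zero_surjective {g : A →ₗ[R] B} (hg : Function.Surjective g)
    (hA : powTorsion I A = ⊤) : Function.Surjective (lcMap I 0 g) := by
  intro z
  obtain ⟨a, ha⟩ := hg (lcZeroTo I B z)
  obtain ⟨n, hn⟩ := mem_powTorsion.1 (hA.ge (Submodule.mem_top (x := a)))
  obtain ⟨y, hy⟩ := exists_lcZeroTo_eq I hn
  exact ⟨y, lcZeroTo_injective I (by rw [lcZeroTo_lcMap, hy, ha])⟩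

lemma exists_embedding_injective_powTorsion [IsNoetherianRing R] (A : Type u)
    [AddCommGroup A] [Module R A] (hA : powTorsion I A = ⊤) :
    ∃ (E : ModuleCat.{u} R) (_ : powTorsion I E = ⊤) (f : A →ₗ[R] E),
      Function.Injective f ∧ Injective E := by
  obtain ⟨E₀, hE₀, ι, hι⟩ : ∃ (E₀ : ModuleCat.{u} R) (_ : Injective E₀)
      (ι : ModuleCat.of R A ⟶ E₀), Mono ι :=
    ⟨Injective.under (ModuleCat.of R A), inferInstance, Injective.ι _, inferInstance⟩
  let f₀ : A →ₗ[R] E₀ := ι.hom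
  have hf₀ : Function.Injective f₀ :=
    (ModuleCat.mono_iff_injective ι).1 hι
  have : Module.Injective R E₀ :=
    Module.injective_module_of_injective_object R E₀ (inj := hE₀)
  refine ⟨ModuleCat.of R (powTorsion I E₀), powTorsion_powTorsion I,
    f₀.codRestrict _ fun a => ?_, fun a b h => hf₀ (congrArg Subtype.val h), ?_⟩
  · obtain ⟨n, hn⟩ := mem_powTorsion.1 (hA.ge (Submodule.mem_top (x := a)))
    exact ⟨n, fun r hr => by rw [← map_smul, hn r hr, map_zero]⟩
  · have := (baer_powTorsion I E₀).injective
    exact Module.injective_object_of_injective_module _ _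

theorem subsingleton_lc_of_powTorsion_eq_top [IsNoetherianRing R] (i : ℕ) (A : Type u)
    [AddCommGroup A] [Module R A] (hA : powTorsion I A = ⊤) : Subsingleton (LC I (i + 1) A) := by
  induction i generalizing A with
  | zero =>
    obtain ⟨E, hE, f, hf, hE'⟩ := exists_embedding_injective_powTorsion I A hA
    have hg := Submodule.mkQ_surjective (LinearMap.range f)
    have hfg : Function.Exact f (Submodule.mkQ (LinearMap.range f)) :=
      LinearMap.exact_map_mkQ_range f
    have hvan (j : ℕ) : Subsingleton (LC I (j + 1) E) := subsingleton_lc_of_injective I j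
    obtain ⟨δ, h1, h2⟩ := exists_lcδ I 0 hf hfg hg
    refine subsingleton_of_forall_eq 0 fun z => ?_
    obtain ⟨y, rfl⟩ := (h2 z).1 (Subsingleton.elim _ _)
    obtain ⟨x, rfl⟩ := lcMap_zero_surjective I hg hE y
    exact h1.apply_apply_eq_zero x
  | succ i ih =>
    obtain ⟨E, hE, f, hf, hE'⟩ := exists_embedding_injective_powTorsion I A hA
    have hg := Submodule.mkQ_surjective (LinearMap.range f)
    have hfg : Function.Exact f (Submodule.mkQ (LinearMap.range f)) :=
      LinearMap.exact_map_mkQ_range f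
    have hvan (j : ℕ) : Subsingleton (LC I (j + 1) E) := subsingleton_lc_of_injective I j
    obtain ⟨δ, h1, h2⟩ := exists_lcδ I (i + 1) hf hfg hg
    have := ih (E ⧸ LinearMap.range f) (powTorsion_eq_top_of_surjective I hg hE)
    refine subsingleton_of_forall_eq 0 fun z => ?_
    obtain ⟨y, rfl⟩ := (h2 z).1 (Subsingleton.elim _ _)
    rw [Subsingleton.elim y 0, map_zero]

end PowTorsion

section ChainsOfPrimes

variable {R : Type u} [CommRing R] {M N : Type*} [AddCommGroup M] [Module R M]
  [AddCommGroup N] [Module R N]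

/-- Every chain of primes of the support of `M` contained in `p` has length less than `k`;
equivalently the module `M_p` has dimension less than `k`. -/
def DimLT (p : PrimeSpectrum R) (M : Type*) [AddCommGroup M] [Module R M] (k : ℕ) : Prop :=
  ∀ c : LTSeries (PrimeSpectrum R), c.head ∈ Module.support R M → c.last ≤ p → c.length < k

lemma DimLT.of_surjective {p : PrimeSpectrum R} {k : ℕ} (h : DimLT p M k) {f : M →ₗ[R] N}
    (hf : Function.Surjective f) : DimLT p N k :=
  fun c hc hp => h c (Module.support_subset_of_surjective f hf hc) hp

lemma DimLT.quotient_smul [IsNoetherianRing R] [Module.Finite R M] {p : PrimeSpectrum R} {k : ℕ}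
    (h : DimLT p M (k + 1)) {x : R} (hx : IsSMulRegular M x) (f : M →ₗ[R] N)
    (hf : Function.Surjective f) (hfx : ∀ n : N, x • n = 0) : DimLT p N k := by
  intro c hc hp
  have hcM := Module.support_subset_of_surjective f hf hc
  have hxc : x ∈ c.head.asIdeal :=
    Module.annihilator_le_of_mem_support hc (Module.mem_annihilator.2 hfx)
  obtain ⟨P, hP, hPc⟩ := Ideal.exists_minimalPrimes_le
    (Module.annihilator_le_of_mem_support hcM)
  have hPa := Module.associatedPrimes.minimalPrimes_annihilator_subset_associatedPrimes R M hP
  have hxP : x ∉ P := fun hxP => by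
    have := (biUnion_associatedPrimes_eq_zero_divisors R M).le (Set.mem_biUnion hPa hxP)
    obtain ⟨m, hm, hxm⟩ := this
    exact hm (hx (by simpa using hxm))
  let P' : PrimeSpectrum R := ⟨P, hP.isPrime⟩
  have hlt : P' < c.head := lt_of_le_of_ne hPc fun h => hxP (h ▸ hxc : x ∈ P'.asIdeal)
  have := h (c.cons P' hlt) (by
    rw [RelSeries.head_cons, Module.support_eq_zeroLocus]
    exact hP.1.2) (by simpa using hp)
  simpa using this

end ChainsOfPrimes

section Reduction

variable {R : Type u} [CommRing R] (I : Ideal R)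

lemma powTorsion_quotient [IsNoetherianRing R] (M : Type u) [AddCommGroup M] [Module R M]
    [Module.Finite R M] : powTorsion I (M ⧸ powTorsion I M) = ⊥ := by
  obtain ⟨k, hk⟩ := exists_pow_smul_eq_zero_of_fg I
    (IsNoetherian.noetherian (powTorsion I M)) le_rfl
  refine eq_bot_iff.2 fun z ⟨n, hn⟩ => ?_
  obtain ⟨a, rfl⟩ := Submodule.Quotient.mk_surjective _ z
  refine (Submodule.Quotient.mk_eq_zero _).2 ⟨k + n, fun r hr => ?_⟩
  rw [pow_add] at hr
  induction hr using Submodule.mul_induction_on' with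
  | mem_mul_mem s hs t ht =>
    rw [mul_smul]
    refine hk s hs _ ?_
    rw [← Submodule.Quotient.mk_eq_zero, Submodule.Quotient.mk_smul]
    exact hn t ht
  | add s _ t _ h1 h2 => rw [add_smul, h1, h2, add_zero]

lemma exists_isSMulRegular_of_powTorsion_eq_bot [IsNoetherianRing R] (M : Type u)
    [AddCommGroup M] [Module R M] [Module.Finite R M] (hM : powTorsion I M = ⊥) :
    ∃ x ∈ I, IsSMulRegular M x := by
  by_contra! H
  have hI : (I : Set R) ⊆ ⋃ p ∈ associatedPrimes R M, (id p : Ideal R) := by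
    intro x hx
    have := H x hx
    simp only [id]
    rw [biUnion_associatedPrimes_eq_zero_divisors R M]
    rw [isSMulRegular_iff_right_eq_zero_of_smul] at this
    push Not at this
    obtain ⟨m, h1, h2⟩ := this
    exact ⟨m, h2, h1⟩
  obtain ⟨p, hp, hIp⟩ := (Ideal.subset_union_prime_finite (associatedPrimes.finite R M) 0 0
    fun p hp _ _ => hp.isPrime).1 hI
  obtain ⟨hp', m, rfl⟩ := isAssociatedPrime_iff.1 hp
  have hm : m ∈ powTorsion I M := ⟨1, fun r hr => by
    simpa using hIp (by simpa using hr)⟩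
  rw [hM, Submodule.mem_bot] at hm
  exact hp'.ne_top (by simp [hm])

/-- Dividing out the `I`-torsion and a regular element of `I` lowers the dimension and
relates the local cohomology of `M` to that of the quotient. -/
theorem exists_lc_sequence [IsNoetherianRing R] (M : Type u) [AddCommGroup M] [Module R M]
    [Module.Finite R M] :
    ∃ (N : ModuleCat.{u} R) (x : R), Module.Finite R N ∧ x ∈ I ∧
      (∀ (p : PrimeSpectrum R) (k : ℕ), DimLT p M (k + 1) → DimLT p N k) ∧
      ∀ i, ∃ (δ : LC I i N →ₗ[R] LC I (i + 1) M) (ρ : LC I (i + 1) M →ₗ[R] LC I (i + 1) N),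
        Function.Exact δ (x • (LinearMap.id : LC I (i + 1) M →ₗ[R] LC I (i + 1) M)) ∧
        Function.Exact (x • (LinearMap.id : LC I (i + 1) M →ₗ[R] LC I (i + 1) M)) ρ := by
  obtain ⟨x, hxI, hx⟩ :=
    exists_isSMulRegular_of_powTorsion_eq_bot I _ (powTorsion_quotient I M)
  set π := (powTorsion I M).mkQ with hπ
  let m : (M ⧸ powTorsion I M) →ₗ[R] (M ⧸ powTorsion I M) := x • LinearMap.id
  let g := (LinearMap.range m).mkQ
  have hg : Function.Surjective g := Submodule.mkQ_surjective _
  have hm : Function.Injective m := hx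
  have hmg : Function.Exact m g := LinearMap.exact_map_mkQ_range m
  refine ⟨ModuleCat.of R ((M ⧸ powTorsion I M) ⧸ LinearMap.range m), x,
    inferInstanceAs (Module.Finite R ((M ⧸ powTorsion I M) ⧸ LinearMap.range m)), hxI,
    fun p k h => (h.of_surjective (f := π) (Submodule.mkQ_surjective _)).quotient_smul hx g hg ?_,
    fun i => ?_⟩
  · intro n
    obtain ⟨a, rfl⟩ := hg n
    exact hmg.apply_apply_eq_zero a
  obtain ⟨δ, h1, h2⟩ := exists_lcδ I i hm hmg hg
  have h3 := lcMap_exact I (i + 1) hm hmg hg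
  have hm' : lcMap I (i + 1) m = x • LinearMap.id := lcMap_smul_id I (i + 1) x
  rw [hm'] at h2 h3
  have hπe : Function.Bijective (lcMap I (i + 1) π) := by
    have hπs : Function.Surjective π := Submodule.mkQ_surjective _
    have hι : Function.Injective (powTorsion I M).subtype := Subtype.val_injective
    have he : Function.Exact (powTorsion I M).subtype π := LinearMap.exact_subtype_mkQ _
    have hv (j : ℕ) : Subsingleton (LC I (j + 1) (powTorsion I M)) :=
      subsingleton_lc_of_powTorsion_eq_top I j _ (powTorsion_powTorsion I)
    constructor
    · rw [injective_iff_map_eq_zero]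
      intro z hz
      obtain ⟨y, rfl⟩ := (lcMap_exact I (i + 1) hι he hπs z).1 hz
      rw [Subsingleton.elim y 0, map_zero]
    · intro z
      obtain ⟨δ', h4, -⟩ := exists_lcδ I (i + 1) hι he hπs
      exact (h4 z).1 (Subsingleton.elim _ _)
  let e := LinearEquiv.ofBijective _ hπe
  refine ⟨e.symm.toLinearMap ∘ₗ δ, lcMap I (i + 1) g ∘ₗ e.toLinearMap, fun z => ?_, fun z => ?_⟩
  · have := h2 (e z)
    simp only [LinearMap.smul_apply, LinearMap.id_apply, ← map_smul,
      EmbeddingLike.map_eq_zero_iff, Set.mem_range] at this ⊢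
    rw [this]
    exact exists_congr fun y => by simp [LinearEquiv.symm_apply_eq]
  · have := h3 (e z)
    refine Iff.trans this ?_
    simp only [LinearMap.smul_apply, LinearMap.id_apply, Set.mem_range]
    constructor
    · rintro ⟨y, hy⟩
      exact ⟨e.symm y, by rw [← map_smul, hy, e.symm_apply_apply]⟩
    · rintro ⟨y, rfl⟩
      exact ⟨e y, (map_smul e x y).symm⟩

end Reduction

section ExtQuotient

variable {R : Type u} [CommRing R] (J : Ideal R) (i : ℕ)
  {A B C : Type u} [AddCommGroup A] [AddCommGroup B] [AddCommGroup C]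
  [Module R A] [Module R B] [Module R C]

abbrev ExtQ (A : Type u) [AddCommGroup A] [Module R A] : Type u :=
  Abelian.Ext (ModuleCat.of R (R ⧸ J)) (ModuleCat.of R A) i

def extQMap (f : A →ₗ[R] B) : ExtQ J i A →ₗ[R] ExtQ J i B :=
  (Abelian.Ext.mk₀ (ModuleCat.ofHom f)).postcompOfLinear R _ (add_zero i)

lemma extQMap_apply (f : A →ₗ[R] B) (z : ExtQ J i A) :
    extQMap J i f z = z.comp (Abelian.Ext.mk₀ (ModuleCat.ofHom f)) (add_zero i) := rfl

lemma extQMap_comp_apply (f : A →ₗ[R] B) (g : B →ₗ[R] C) (z : ExtQ J i A) :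
    extQMap J i g (extQMap J i f z) = extQMap J i (g ∘ₗ f) z := by
  simp [extQMap_apply]

lemma extQMap_smul_id_eq_zero {x : R} (hx : x ∈ J) (z : ExtQ J i A) :
    extQMap J i (x • (LinearMap.id : A →ₗ[R] A)) z = 0 := by
  have h0 : x • 𝟙 (ModuleCat.of R (R ⧸ J)) = 0 := by
    ext
    change x • (Submodule.Quotient.mk 1 : R ⧸ J) = 0
    rw [← Submodule.Quotient.mk_smul, Submodule.Quotient.mk_eq_zero]
    simpa using hx
  have h1 : extQMap J i (x • (LinearMap.id : A →ₗ[R] A)) z = x • z :=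
    (Abelian.Ext.smul_eq_comp_mk₀ z x).symm
  rw [h1, ← Abelian.Ext.mk₀_id_comp z, ← Abelian.Ext.smul_comp, ← Abelian.Ext.mk₀_smul, h0,
    Abelian.Ext.mk₀_zero, Abelian.Ext.zero_comp]

lemma extQMap_zero : extQMap J i (0 : A →ₗ[R] B) = 0 := by
  ext z
  rw [extQMap_apply, ModuleCat.ofHom_zero, Abelian.Ext.mk₀_zero, Abelian.Ext.comp_zero]
  rfl

lemma extQMap_exact {f : A →ₗ[R] B} {g : B →ₗ[R] C} (hf : Function.Injective f)
    (hfg : Function.Exact f g) (hg : Function.Surjective g) :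
    Function.Exact (extQMap J i f) (extQMap J i g) := by
  have hS := shortExact_ofHom f g hf hfg hg
  intro z
  constructor
  · exact Abelian.Ext.covariant_sequence_exact₂ _ hS z
  · rintro ⟨y, rfl⟩
    rw [extQMap_comp_apply, hfg.linearMap_comp_eq_zero, extQMap_zero, LinearMap.zero_apply]

/-- All the modules `Ext^i(R/J, A)` are finitely generated. -/
def ExtFin (A : Type u) [AddCommGroup A] [Module R A] : Prop :=
  ∀ i, Module.Finite R (ExtQ J i A)

variable {J}

lemma ExtFin.of_finite [IsNoetherianRing R] [Module.Finite R A] : ExtFin J A :=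
  fun i => ModuleCat.finite_ext R (ModuleCat.of R (R ⧸ J)) (ModuleCat.of R A) i

lemma ExtFin.of_equiv (h : ExtFin J A) (e : A ≃ₗ[R] B) : ExtFin J B := by
  intro i
  have := h i
  refine Module.Finite.of_surjective (extQMap J i e.toLinearMap) fun z =>
    ⟨extQMap J i e.symm.toLinearMap z, ?_⟩
  rw [extQMap_comp_apply]
  simp [extQMap_apply]

lemma ExtFin.isNoetherian_ker_extQMap [IsNoetherianRing R] (hC : ExtFin J C)
    {f : A →ₗ[R] B} {g : B →ₗ[R] C} (hf : Function.Injective f)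
    (hfg : Function.Exact f g) (hg : Function.Surjective g) :
    IsNoetherian R (LinearMap.ker (extQMap J i f)) := by
  have hS := shortExact_ofHom f g hf hfg hg
  cases i with
  | zero =>
    have : Mono (ModuleCat.ofHom f) := (ModuleCat.mono_iff_injective _).2 hf
    have hinj : Function.Injective (extQMap J 0 f) :=
      Abelian.Ext.postcomp_mk₀_injective_of_mono (ModuleCat.of R (R ⧸ J)) (ModuleCat.ofHom f)
    rw [LinearMap.ker_eq_bot.2 hinj]
    infer_instance
  | succ i =>
    let δ : ExtQ J i C →ₗ[R] ExtQ J (i + 1) A := hS.extClass.postcompOfLinear R _ rfl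
    have hle : LinearMap.ker (extQMap J (i + 1) f) ≤ LinearMap.range δ := fun z hz =>
      Abelian.Ext.covariant_sequence_exact₁ _ hS z hz rfl
    have := hC i
    exact isNoetherian_of_le hle

/-- If `x ∈ J` and both the kernel and the cokernel of multiplication by `x` have finitely
generated `Ext^i(R/J, -)`, so does the module. -/
theorem ExtFin.of_ker_of_coker [IsNoetherianRing R] {x : R} (hx : x ∈ J)
    (hK : ExtFin J (LinearMap.ker (x • (LinearMap.id : A →ₗ[R] A))))
    (hQ : ExtFin J (A ⧸ LinearMap.range (x • (LinearMap.id : A →ₗ[R] A)))) : ExtFin J A := by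
  intro i
  set m : A →ₗ[R] A := x • LinearMap.id with hm
  have h1 := extQMap_exact J i (f := (LinearMap.ker m).subtype) (g := m.rangeRestrict)
    Subtype.val_injective (by
      rw [LinearMap.exact_iff, LinearMap.ker_rangeRestrict, Submodule.range_subtype])
    m.surjective_rangeRestrict
  have h2 := hQ.isNoetherian_ker_extQMap i (f := (LinearMap.range m).subtype)
    (g := (LinearMap.range m).mkQ) Subtype.val_injective (LinearMap.exact_subtype_mkQ _)
    (Submodule.mkQ_surjective _)
  let φ : ExtQ J i A →ₗ[R] LinearMap.ker (extQMap J i (LinearMap.range m).subtype) :=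
    (extQMap J i m.rangeRestrict).codRestrict _ fun z => by
      rw [LinearMap.mem_ker, extQMap_comp_apply]
      exact extQMap_smul_id_eq_zero J i hx z
  have := hK i
  have := isNoetherian_of_range_eq_ker (extQMap J i (LinearMap.ker m).subtype) φ (by
    rw [LinearMap.ker_codRestrict]
    exact h1.linearMap_ker_eq.symm)
  infer_instance

variable (J)

/-- Every submodule and every quotient of `A` has finitely generated `Ext^i(R/J, -)`. -/
def HExtFin (A : Type u) [AddCommGroup A] [Module R A] : Prop :=
  ∀ U : Submodule R A, ExtFin J U ∧ ExtFin J (A ⧸ U)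

variable {J}

lemma HExtFin.of_finite [IsNoetherianRing R] [Module.Finite R A] : HExtFin J A :=
  fun _ => ⟨.of_finite, .of_finite⟩

theorem HExtFin.extFin_of_exact [IsNoetherianRing R] (hA : HExtFin J A) (hC : HExtFin J C)
    {x : R} (hx : x ∈ J) {d : A →ₗ[R] B} {r : B →ₗ[R] C}
    (hd : Function.Exact d (x • (LinearMap.id : B →ₗ[R] B)))
    (hr : Function.Exact (x • (LinearMap.id : B →ₗ[R] B)) r) : ExtFin J B := by
  refine .of_ker_of_coker hx ?_ ?_
  · rw [hd.linearMap_ker_eq]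
    exact (hA _).2.of_equiv d.quotKerEquivRange
  · rw [← hr.linearMap_ker_eq]
    exact (hC _).1.of_equiv r.quotKerEquivRange.symm

end ExtQuotient

section ArtinianKernel

variable {R : Type u} [CommRing R] {J : Ideal R} {y : R}
  {A : Type u} [AddCommGroup A] [Module R A]

lemma isNoetherian_ker_pow_smul [IsNoetherian R (LinearMap.ker (y • (LinearMap.id : A →ₗ[R] A)))]
    (n : ℕ) : IsNoetherian R (LinearMap.ker ((y ^ n) • (LinearMap.id : A →ₗ[R] A))) := by
  induction n with
  | zero =>
    have : LinearMap.ker ((y ^ 0) • (LinearMap.id : A →ₗ[R] A)) = ⊥ := by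
      ext; simp
    rw [this]
    infer_instance
  | succ n ih =>
    let f : LinearMap.ker ((y ^ (n + 1)) • (LinearMap.id : A →ₗ[R] A)) →ₗ[R]
        LinearMap.ker (y • (LinearMap.id : A →ₗ[R] A)) :=
      ((y ^ n • LinearMap.id) ∘ₗ Submodule.subtype _).codRestrict _ fun z => by
        have := z.2
        simpa [smul_smul, pow_succ', mul_comm] using this
    have hle : LinearMap.ker ((y ^ n) • (LinearMap.id : A →ₗ[R] A)) ≤
        LinearMap.ker ((y ^ (n + 1)) • (LinearMap.id : A →ₗ[R] A)) := fun z hz => by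
      simp only [LinearMap.mem_ker, LinearMap.smul_apply, LinearMap.id_apply] at hz ⊢
      rw [pow_succ', mul_smul, hz, smul_zero]
    refine isNoetherian_of_range_eq_ker (Submodule.inclusion hle) f ?_
    ext z
    simp [f, Submodule.range_inclusion]

lemma exists_pow_smul_sub_eq_zero (hA : ∀ a : A, ∃ n, y ^ n • a = 0)
    [IsArtinian R (LinearMap.ker (y • (LinearMap.id : A →ₗ[R] A)))] (C : Submodule R A) :
    ∃ n, ∀ c ∈ C, ∃ c' ∈ C, y ^ n • (c - y • c') = 0 := by
  let K := LinearMap.ker (y • (LinearMap.id : A →ₗ[R] A))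
  let D : ℕ →o (Submodule R K)ᵒᵈ :=
    { toFun m := OrderDual.toDual ((C.map (y ^ m • (LinearMap.id : A →ₗ[R] A))).comap K.subtype)
      monotone' := by
        intro m k hmk
        refine OrderDual.toDual_le_toDual.2 (Submodule.comap_mono ?_)
        rintro _ ⟨c, hc, rfl⟩
        refine ⟨y ^ (k - m) • c, C.smul_mem _ hc, ?_⟩
        simp [smul_smul, ← pow_add, Nat.sub_add_cancel hmk] }
  obtain ⟨n, hn⟩ := IsArtinian.monotone_stabilizes D
  have key (e : ℕ) : ∀ m, n ≤ m → ∀ c ∈ C, y ^ e • y ^ n • c = 0 →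
      ∃ c' ∈ C, y ^ m • c' = y ^ n • c := by
    induction e with
    | zero =>
      intro m _ c _ h
      exact ⟨0, C.zero_mem, by simpa using h.symm⟩
    | succ e ih =>
      intro m hm c hc h
      have hk : y ^ e • y ^ n • c ∈ K := by
        simpa [K, smul_smul, pow_succ', mul_assoc, mul_comm, mul_left_comm] using h
      have h1 : (⟨_, hk⟩ : K) ∈ OrderDual.ofDual (D n) := by
        rw [hn (n + e) (by omega)]
        exact ⟨c, hc, by simp [smul_smul, ← pow_add, add_comm]⟩
      rw [hn (m + e) (by omega)] at h1
      obtain ⟨c', hc', h2⟩ := h1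
      simp only [LinearMap.smul_apply, LinearMap.id_apply, Submodule.subtype_apply] at h2
      obtain ⟨c'', hc'', h3⟩ := ih m hm (c - y ^ (m - n) • c')
        (C.sub_mem hc (C.smul_mem _ hc')) (by
          rw [smul_sub, smul_sub, ← h2, smul_smul, smul_smul, ← pow_add, ← pow_add, sub_eq_zero]
          congr 2
          omega)
      refine ⟨c'' + c', C.add_mem hc'' hc', ?_⟩
      rw [smul_add, h3, smul_sub, smul_smul, ← pow_add, Nat.add_sub_cancel' hm, sub_add_cancel]
  refine ⟨n, fun c hc => ?_⟩
  obtain ⟨e, he⟩ := hA (y ^ n • c)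
  obtain ⟨c', hc', h⟩ := key e (n + 1) (by omega) c hc he
  refine ⟨c', hc', ?_⟩
  rw [smul_sub, ← h, smul_smul, ← pow_succ, sub_self]

theorem HExtFin.of_isArtinian_ker [IsNoetherianRing R] (hy : y ∈ J)
    (hA : ∀ a : A, ∃ n, y ^ n • a = 0)
    [IsNoetherian R (LinearMap.ker (y • (LinearMap.id : A →ₗ[R] A)))]
    [IsArtinian R (LinearMap.ker (y • (LinearMap.id : A →ₗ[R] A)))]
    (hyA : ∀ a : A, ∃ b, y • b = a) : HExtFin J A := by
  intro C
  obtain ⟨n, hn⟩ := exists_pow_smul_sub_eq_zero hA C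
  have hker (n : ℕ) := isNoetherian_ker_pow_smul (y := y) (A := A) n
  constructor
  · have hC (n : ℕ) : IsNoetherian R (LinearMap.ker ((y ^ n) • (LinearMap.id : C →ₗ[R] C))) := by
      let f : LinearMap.ker ((y ^ n) • (LinearMap.id : C →ₗ[R] C)) →ₗ[R]
          LinearMap.ker ((y ^ n) • (LinearMap.id : A →ₗ[R] A)) :=
        (C.subtype ∘ₗ Submodule.subtype _).codRestrict _ fun z => congrArg Subtype.val z.2
      have := hker n
      exact isNoetherian_of_injective f fun a b h =>
        Subtype.ext (Subtype.ext (congrArg (fun z => Subtype.val z) h :))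
    refine .of_ker_of_coker hy ?_ ?_
    · have := hC 1
      rw [pow_one] at this
      exact .of_finite
    · have := hC n
      have : Module.Finite R (C ⧸ LinearMap.range (y • (LinearMap.id : C →ₗ[R] C))) := by
        refine Module.Finite.of_surjective
          (Submodule.mkQ _ ∘ₗ (LinearMap.ker ((y ^ n) • (LinearMap.id : C →ₗ[R] C))).subtype) ?_
        intro z
        obtain ⟨⟨c, hc⟩, rfl⟩ := Submodule.mkQ_surjective _ z
        obtain ⟨c', hc', h⟩ := hn c hc
        refine ⟨⟨⟨c, hc⟩ - y • ⟨c', hc'⟩, Subtype.ext h⟩, ?_⟩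
        refine (Submodule.Quotient.eq _).2 ⟨-⟨c', hc'⟩, ?_⟩
        ext
        simp
      exact .of_finite
  · refine .of_ker_of_coker hy ?_ ?_
    · have hle : LinearMap.ker (y • (LinearMap.id : (A ⧸ C) →ₗ[R] (A ⧸ C))) ≤
          (LinearMap.ker ((y ^ (n + 1)) • (LinearMap.id : A →ₗ[R] A))).map C.mkQ := by
        intro z hz
        obtain ⟨a, rfl⟩ := Submodule.mkQ_surjective _ z
        have ha : y • a ∈ C := (Submodule.Quotient.mk_eq_zero C).1 hz
        obtain ⟨c, hc, h⟩ := hn _ ha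
        refine ⟨a - c, ?_, ?_⟩
        · simpa [pow_succ, mul_smul, smul_sub] using h
        · simpa using hc
      have := hker (n + 1)
      have := isNoetherian_of_le hle
      exact .of_finite
    · have : LinearMap.range (y • (LinearMap.id : (A ⧸ C) →ₗ[R] (A ⧸ C))) = ⊤ := by
        refine eq_top_iff.2 fun z _ => ?_
        obtain ⟨a, rfl⟩ := Submodule.mkQ_surjective _ z
        obtain ⟨b, rfl⟩ := hyA a
        exact ⟨C.mkQ b, by simp⟩
      rw [this]
      exact .of_finite

end ArtinianKernel

section LocalizedLocalCohomology

lemma isArtinian_of_krullDimLE_zero_annihilator {S L : Type*} [CommRing S] [IsNoetherianRing S]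
    [AddCommGroup L] [Module S L] [Module.Finite S L]
    (h : Ring.KrullDimLE 0 (S ⧸ Module.annihilator S L)) : IsArtinian S L := by
  let := Module.quotientAnnihilator (R := S) (M := L)
  have : IsScalarTower S (S ⧸ Module.annihilator S L) L :=
    (Module.isTorsionBySet_annihilator S L).isScalarTower
  have := IsNoetherianRing.isArtinianRing_of_krullDimLE_zero (R := S ⧸ Module.annihilator S L)
  have : Module.Finite (S ⧸ Module.annihilator S L) L :=
    Module.Finite.of_restrictScalars_finite S _ _
  exact (isArtinian_of_surjective_algebraMap (S := S) (R := S ⧸ Module.annihilator S L)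
    Ideal.Quotient.mk_surjective)

variable {R : Type u} [CommRing R] (I : Ideal R) (p : PrimeSpectrum R)

/-- The localization of the local cohomology module `H^i_I(M)` at the prime `p`. -/
abbrev LocLC (i : ℕ) (M : Type u) [AddCommGroup M] [Module R M] : Type u :=
  LocalizedModule p.asIdeal.primeCompl (LC I i M)

abbrev locIdeal : Ideal (Localization.AtPrime p.asIdeal) :=
  I.map (algebraMap R (Localization.AtPrime p.asIdeal))

lemma localizedModule_map_smul_id (s : Submonoid R) (M : Type*) [AddCommGroup M] [Module R M]
    (x : R) :
    LocalizedModule.map s (x • (LinearMap.id : M →ₗ[R] M)) =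
      algebraMap R (Localization s) x • LinearMap.id := by
  ext z
  induction z using LocalizedModule.induction_on with
  | h m t =>
    simp [LocalizedModule.smul'_mk]

lemma locLC_torsion (i : ℕ) (M : Type u) [AddCommGroup M] [Module R M]
    (z : LocLC I p i M) :
    ∃ n, ∀ y ∈ locIdeal I p ^ n, y • z = 0 := by
  induction z using LocalizedModule.induction_on with
  | h m t =>
    obtain ⟨n, hn⟩ := exists_pow_smul_lc_eq_zero I i m
    refine ⟨n, fun y hy => ?_⟩
    rw [← Ideal.map_pow] at hy
    induction hy using Submodule.span_induction with
    | mem _ h =>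
      obtain ⟨r, hr, rfl⟩ := h
      rw [algebraMap_smul, LocalizedModule.smul'_mk, hn r hr, LocalizedModule.zero_mk]
    | zero => simp
    | add _ _ _ _ h1 h2 => rw [add_smul, h1, h2, add_zero]
    | smul a _ _ h => rw [smul_eq_mul, mul_smul, h, smul_zero]

variable {p} in
lemma subsingleton_locLC_of_dimLT_zero {M : Type u} [AddCommGroup M] [Module R M]
    [Module.Finite R M] (h : DimLT p M 0) (i : ℕ) :
    Subsingleton (LocLC I p i M) := by
  have hp : p ∉ Module.support R M := fun hp =>
    Nat.not_lt_zero _ (h (RelSeries.singleton _ p) hp le_rfl)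
  rw [Module.mem_support_iff_of_finite, SetLike.not_le_iff_exists] at hp
  obtain ⟨r, hr, hrp⟩ := hp
  rw [LocalizedModule.subsingleton_iff]
  exact fun z => ⟨r, hrp, smul_lc_eq_zero I i (Module.mem_annihilator.1 hr) z⟩

variable [IsNoetherianRing R] (M : Type u) [AddCommGroup M] [Module R M] [Module.Finite R M]

theorem exists_locLC_sequence :
    ∃ (N : ModuleCat.{u} R) (y : Localization.AtPrime p.asIdeal), Module.Finite R N ∧
      y ∈ locIdeal I p ∧ (∀ k : ℕ, DimLT p M (k + 1) → DimLT p N k) ∧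
      ∀ i, ∃ (δ : LocLC I p i N →ₗ[Localization.AtPrime p.asIdeal] LocLC I p (i + 1) M)
        (ρ : LocLC I p (i + 1) M →ₗ[Localization.AtPrime p.asIdeal] LocLC I p (i + 1) N),
        Function.Exact δ (y • (LinearMap.id :
          LocLC I p (i + 1) M →ₗ[Localization.AtPrime p.asIdeal] LocLC I p (i + 1) M)) ∧
        Function.Exact (y • (LinearMap.id :
          LocLC I p (i + 1) M →ₗ[Localization.AtPrime p.asIdeal] LocLC I p (i + 1) M)) ρ := by
  obtain ⟨N, x, hN, hx, hd, h⟩ := exists_lc_sequence I M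
  refine ⟨N, algebraMap _ _ x, hN, Ideal.mem_map_of_mem _ hx, hd p, fun i => ?_⟩
  obtain ⟨δ, ρ, h1, h2⟩ := h i
  refine ⟨LocalizedModule.map _ δ, LocalizedModule.map _ ρ, ?_, ?_⟩
  · rw [← localizedModule_map_smul_id]
    exact LocalizedModule.map_exact p.asIdeal.primeCompl _ _ h1
  · rw [← localizedModule_map_smul_id]
    exact LocalizedModule.map_exact p.asIdeal.primeCompl _ _ h2

variable {M p}

theorem subsingleton_locLC_of_dimLT {k : ℕ} (h : DimLT p M k) {i : ℕ} (hi : k ≤ i) :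
    Subsingleton (LocLC I p i M) := by
  induction k generalizing M i with
  | zero => exact subsingleton_locLC_of_dimLT_zero I h i
  | succ k ih =>
    obtain ⟨i, rfl⟩ : ∃ j, i = j + 1 := ⟨i - 1, by omega⟩
    obtain ⟨N, y, hN, hy, hd, hs⟩ := exists_locLC_sequence I p M
    obtain ⟨δ, -, h1, -⟩ := hs i
    have : Subsingleton (LocLC I p i N) := ih (hd k h) (by omega)
    have hinj (z : LocLC I p (i + 1) M) (hz : y • z = 0) : z = 0 := by
      obtain ⟨w, rfl⟩ := (h1 z).1 hz
      rw [Subsingleton.elim w 0, map_zero]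
    refine subsingleton_of_forall_eq 0 fun z => ?_
    obtain ⟨n, hn⟩ := locLC_torsion I p (i + 1) M z
    replace hn := hn _ (Ideal.pow_mem_pow hy n)
    induction n with
    | zero => simpa using hn
    | succ n ihn => exact ihn (hinj _ (by rwa [← mul_smul, ← pow_succ']))

lemma finite_locLC_zero : Module.Finite (Localization.AtPrime p.asIdeal) (LocLC I p 0 M) :=
  have := finite_lc_zero I (A := M)
  inferInstance

theorem isArtinian_locLC_zero (h : DimLT p M 1) :
    IsArtinian (Localization.AtPrime p.asIdeal) (LocLC I p 0 M) := by
  set S := Localization.AtPrime p.asIdeal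
  set L := LocLC I p 0 M
  have := finite_locLC_zero I (p := p) (M := M)
  have hdim : Ring.KrullDimLE 0 (S ⧸ Module.annihilator S L) := by
    refine Ring.krullDimLE_zero_iff.2 fun Q hQ => ?_
    let π := Ideal.Quotient.mk (Module.annihilator S L)
    have hπ : Function.Surjective π := Ideal.Quotient.mk_surjective
    have hQ' : (Q.comap π).IsPrime := Ideal.comap_isPrime π Q
    have hQ'' : ((Q.comap π).comap (algebraMap R S)).IsPrime := Ideal.comap_isPrime _ _
    let q : PrimeSpectrum R := ⟨_, hQ''⟩
    have hqp : q ≤ p := by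
      intro r hr
      by_contra hrp
      exact hQ'.ne_top (Ideal.eq_top_of_isUnit_mem _ hr
        (IsLocalization.map_units S (⟨r, hrp⟩ : p.asIdeal.primeCompl)))
    have hq : q ∈ Module.support R M := by
      rw [Module.mem_support_iff_of_finite]
      intro r hr
      have : algebraMap R S r ∈ Module.annihilator S L := by
        rw [Module.mem_annihilator]
        intro z
        induction z using LocalizedModule.induction_on with
        | h m t =>
          rw [algebraMap_smul, LocalizedModule.smul'_mk,
            smul_lc_eq_zero I 0 (Module.mem_annihilator.1 hr), LocalizedModule.zero_mk]
      change π (algebraMap R S r) ∈ Q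
      rw [Ideal.Quotient.eq_zero_iff_mem.2 this]
      exact Q.zero_mem
    have hqp' : q = p := by
      by_contra hne
      have hlt : q < p := lt_of_le_of_ne hqp hne
      let c : LTSeries (PrimeSpectrum R) := RelSeries.singleton _ p
      let d : LTSeries (PrimeSpectrum R) := c.cons q hlt
      have hd : d.head = q := RelSeries.head_cons ..
      have hd' : d.last = p := RelSeries.last_cons ..
      exact lt_irrefl 1 (h d (hd ▸ hq) hd'.le)
    have hmax : Q.comap π = IsLocalRing.maximalIdeal S := by
      refine (IsLocalRing.le_maximalIdeal hQ'.ne_top).antisymm ?_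
      rw [← Localization.AtPrime.map_eq_maximalIdeal, Ideal.map_le_iff_le_comap]
      exact (congrArg PrimeSpectrum.asIdeal hqp').ge
    have : (Q.comap π).IsMaximal := hmax ▸ inferInstance
    rw [← Ideal.map_comap_of_surjective π hπ Q]
    exact (Ideal.map_eq_top_or_isMaximal_of_surjective π hπ this).resolve_left fun h =>
      hQ.ne_top (by rwa [Ideal.map_comap_of_surjective π hπ Q] at h)
  exact isArtinian_of_krullDimLE_zero_annihilator hdim

theorem hExtFin_locLC_of_dimLT_two (h : DimLT p M 2) (i : ℕ) :
    HExtFin (locIdeal I p) (LocLC I p i M) := by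
  match i with
  | 0 =>
    have := finite_locLC_zero I (p := p) (M := M)
    exact .of_finite
  | 1 =>
    obtain ⟨N, y, hN, hy, hd, hs⟩ := exists_locLC_sequence I p M
    obtain ⟨δ, ρ, h1, h2⟩ := hs 0
    have hN1 := hd 1 h
    have := subsingleton_locLC_of_dimLT I hN1 le_rfl
    have := finite_locLC_zero I (p := p) (M := N)
    have := isArtinian_locLC_zero I hN1
    have hK := h1.linearMap_ker_eq
    have : IsNoetherian (Localization.AtPrime p.asIdeal) (LinearMap.range δ) :=
      isNoetherian_of_surjective _ (LinearMap.range_eq_top.2 δ.surjective_rangeRestrict)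
    have : IsArtinian (Localization.AtPrime p.asIdeal) (LinearMap.range δ) :=
      isArtinian_of_surjective _ _ δ.surjective_rangeRestrict
    rw [← hK] at *
    refine .of_isArtinian_ker hy (fun z => ?_) fun z => ?_
    · obtain ⟨n, hn⟩ := locLC_torsion I p 1 M z
      exact ⟨n, hn _ (Ideal.pow_mem_pow hy n)⟩
    · exact (h2 z).1 (Subsingleton.elim _ _)
  | i + 2 =>
    have := subsingleton_locLC_of_dimLT I h (i := i + 2) (by omega)
    exact .of_finite

theorem extFin_locLC_of_dimLT_three (h : DimLT p M 3) (i : ℕ) :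
    ExtFin (locIdeal I p) (LocLC I p i M) := by
  cases i with
  | zero =>
    have := finite_locLC_zero I (p := p) (M := M)
    exact .of_finite
  | succ i =>
    obtain ⟨N, y, hN, hy, hd, hs⟩ := exists_locLC_sequence I p M
    obtain ⟨δ, ρ, h1, h2⟩ := hs i
    exact (hExtFin_locLC_of_dimLT_two I (hd 2 h) i).extFin_of_exact
      (hExtFin_locLC_of_dimLT_two I (hd 2 h) (i + 1)) hy h1 h2

theorem isCofinite_locLC_of_dimLT_three (h : DimLT p M 3) (i : ℕ) :
    IsCofinite (Localization.AtPrime p.asIdeal) (locIdeal I p)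
      (ModuleCat.of (Localization.AtPrime p.asIdeal) (LocLC I p i M)) := by
  refine ⟨fun q hq => ?_, fun j => ?_⟩
  · obtain ⟨z, hz⟩ := Module.mem_support_iff'.1 hq
    obtain ⟨n, hn⟩ := locLC_torsion I p i M z
    intro y hy
    by_contra hyq
    exact hz (y ^ n) (fun h => hyq (q.isPrime.mem_of_pow_mem n h)) (hn _ (Ideal.pow_mem_pow hy n))
  · have := extFin_locLC_of_dimLT_three I h i j
    exact Module.Finite.equiv (extComparison _ _ j).symm

end LocalizedLocalCohomology

section PuncturedSpectrum

lemma dimLT_of_ne_closedPoint {R : Type u} [CommRing R] [IsLocalRing R] {M : Type u}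
    [AddCommGroup M] [Module R M] [Module.Finite R M] {k : ℕ} (hM : moduleDim R M ≤ k)
    {p : PrimeSpectrum R} (hp : p ≠ IsLocalRing.closedPoint R) : DimLT p M k := by
  intro c hc hcp
  have hlt : c.last < IsLocalRing.closedPoint R :=
    hcp.trans_lt (lt_of_le_of_ne (IsLocalRing.le_maximalIdeal p.isPrime.ne_top) hp)
  let d : LTSeries (PrimeSpectrum R) := c.snoc _ hlt
  have hd : d.head = c.head := RelSeries.head_snoc ..
  have hmem (i : Fin (d.length + 1)) :
      d i ∈ PrimeSpectrum.zeroLocus (Module.annihilator R M : Set R) := by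
    rw [← Module.support_eq_zeroLocus]
    exact Module.mem_support_mono (LTSeries.head_le d i) (hd ▸ hc)
  rw [moduleDim, ringKrullDim_quotient] at hM
  let e : LTSeries (PrimeSpectrum.zeroLocus (Module.annihilator R M : Set R)) :=
    ⟨d.length, fun i => ⟨d i, hmem i⟩, fun i => d.step i⟩
  have he : ((c.length + 1 : ℕ) : WithBot ℕ∞) ≤ k := (Order.LTSeries.length_le_krullDim e).trans hM
  exact_mod_cast he

end PuncturedSpectrum

theorem stmt16 (R : Type u) [CommRing R] [IsNoetherianRing R] [IsLocalRing R]
    (I : Ideal R) (M : Type u) [AddCommGroup M] [Module R M] [Module.Finite R M]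
    (h3 : moduleDim R M ≤ 3) :
    (∃ D : Ideal R, ringKrullDim (R ⧸ D) ≤ 1 ∧
      ∀ p : PrimeSpectrum R, p ∉ PrimeSpectrum.zeroLocus (D : Set R) → ∀ i : ℕ,
        IsCofinite (Localization.AtPrime p.asIdeal)
          (I.map (algebraMap R (Localization.AtPrime p.asIdeal)))
          (ModuleCat.of (Localization.AtPrime p.asIdeal)
            (LocalizedModule p.asIdeal.primeCompl
              ↥((localCohomology I i).obj (ModuleCat.of R M))))) ∧
    {p : PrimeSpectrum R | ∃ i : ℕ,
      ¬ IsCofinite (Localization.AtPrime p.asIdeal)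
          (I.map (algebraMap R (Localization.AtPrime p.asIdeal)))
          (ModuleCat.of (Localization.AtPrime p.asIdeal)
            (LocalizedModule p.asIdeal.primeCompl
              ↥((localCohomology I i).obj (ModuleCat.of R M))))}.Finite := by
  refine ⟨⟨IsLocalRing.maximalIdeal R, ?_, fun p hp i => ?_⟩, ?_⟩
  · let := Ideal.Quotient.field (IsLocalRing.maximalIdeal R)
    rw [ringKrullDim_eq_zero_of_field]
    exact zero_le_one
  · refine isCofinite_locLC_of_dimLT_three I (dimLT_of_ne_closedPoint h3 ?_) i
    rintro rfl
    exact hp (Set.Subset.refl _)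
  · refine (Set.finite_singleton (IsLocalRing.closedPoint R)).subset fun p ⟨i, hi⟩ => ?_
    by_contra hp
    exact hi (isCofinite_locLC_of_dimLT_three I (dimLT_of_ne_closedPoint h3 hp) i)
end
end
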